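/- arXiv:2110.15416 — 5 statements merged into one kernel-verified Lean document; each statement's English description precedes it below -/
import Mathlib

section
/- Let P(λ)∈ℂ[λ]^{m×n} be a polynomial matrix whose nonzero partial multiplicities at a point λ_0∈ℂ are 0<σ_1≤…≤σ_s, and let r_1(λ),…,r_s(λ) be a complete set of root polynomials at λ_0 for P(λ), ordered so that their orders satisfy k_1≥…≥k_s>0. Then the following are equivalent: (i) r_1(λ),…,r_s(λ) is a maximal set of root polynomials at λ_0 for P(λ); (ii) the multiset of orders {k_1,…,k_s} equals the multiset {σ_1,…,σ_s}; (iii) k_1+…+k_s = σ_1+…+σ_s. -/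
open Polynomial Matrix

noncomputable section

/-- The matrix pencil `L₀ + λ L₁` viewed as a polynomial matrix. -/
def pencilMat {ι κ : Type*} (L0 L1 : Matrix ι κ ℂ) : Matrix ι κ (Polynomial ℂ) :=
  Matrix.of fun i j => Polynomial.C (L0 i j) + Polynomial.X * Polynomial.C (L1 i j)

/-- Entrywise evaluation of a polynomial matrix at a point. -/
def evalMat {ι κ : Type*} (P : Matrix ι κ (Polynomial ℂ)) (μ : ℂ) : Matrix ι κ ℂ :=
  P.map fun p => p.eval μ

/-- A polynomial matrix viewed over the field ℂ(λ) of rational functions. -/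
def toRat {ι κ : Type*} (P : Matrix ι κ (Polynomial ℂ)) : Matrix ι κ (RatFunc ℂ) :=
  P.map (algebraMap (Polynomial ℂ) (RatFunc ℂ))

/-- The normal rank of a polynomial matrix: its rank over ℂ(λ). -/
def normalRank {ι κ : Type*} [Fintype κ] (P : Matrix ι κ (Polynomial ℂ)) : ℕ :=
  (toRat P).rank

/-- The right nullspace of a polynomial matrix, as a ℂ(λ)-subspace of ℂ(λ)^κ. -/
def rightNullspace {ι κ : Type*} [Fintype κ] (P : Matrix ι κ (Polynomial ℂ)) :
    Submodule (RatFunc ℂ) (κ → RatFunc ℂ) :=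
  LinearMap.ker (toRat P).mulVecLin

/-- The degree of a polynomial (column) vector: maximum of the degrees of its entries. -/
def colDegree {ι : Type*} [Fintype ι] (v : ι → Polynomial ℂ) : ℕ :=
  Finset.univ.sup fun i => (v i).natDegree

/-- The columns of the polynomial matrix `N` form a minimal polynomial basis of the right
nullspace of `P`: they are a ℂ(λ)-basis of `rightNullspace P` and the sum of the column
degrees is minimal among all polynomial bases. -/
def IsMinimalBasis {ι κ : Type*} [Fintype ι] [Fintype κ] (P : Matrix ι κ (Polynomial ℂ))
    {p : ℕ} (N : Matrix κ (Fin p) (Polynomial ℂ)) : Prop :=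
  LinearIndependent (RatFunc ℂ) (fun j : Fin p => fun i : κ => toRat N i j) ∧
  Submodule.span (RatFunc ℂ) (Set.range fun j : Fin p => fun i : κ => toRat N i j)
    = rightNullspace P ∧
  ∀ M : Matrix κ (Fin p) (Polynomial ℂ),
    LinearIndependent (RatFunc ℂ) (fun j : Fin p => fun i : κ => toRat M i j) →
    Submodule.span (RatFunc ℂ) (Set.range fun j : Fin p => fun i : κ => toRat M i j)
      = rightNullspace P →
    (∑ j, colDegree fun i => N i j) ≤ ∑ j, colDegree fun i => M i j

/-- `x(λ)` is a right zero direction of order `k ≥ 1` for `P` at `λ₀`: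
`x(λ₀) ≠ 0` and `P(λ)x(λ) = (λ-λ₀)^k v(λ)` with `v` defined and nonzero at `λ₀`. -/
def IsZeroDirection {ι κ : Type*} [Fintype κ] (P : Matrix ι κ (Polynomial ℂ)) (lam0 : ℂ)
    (k : ℕ) (x : κ → Polynomial ℂ) : Prop :=
  0 < k ∧ (fun i => (x i).eval lam0) ≠ 0 ∧
  (∀ i, (Polynomial.X - Polynomial.C lam0) ^ k ∣ P.mulVec x i) ∧
  ¬ ∀ i, (Polynomial.X - Polynomial.C lam0) ^ (k + 1) ∣ P.mulVec x i

/-- `x(λ)` is a root polynomial of order (exactly) `k` at `λ₀` for `P`: it is a zero direction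
of order `k` and, for every right minimal basis `N` of `P`, `[N(λ₀) x(λ₀)]` has full column
rank. -/
def IsRootPoly {ι κ : Type*} [Fintype ι] [Fintype κ] (P : Matrix ι κ (Polynomial ℂ)) (lam0 : ℂ)
    (k : ℕ) (x : κ → Polynomial ℂ) : Prop :=
  IsZeroDirection P lam0 k x ∧
  ∀ (p : ℕ) (N : Matrix κ (Fin p) (Polynomial ℂ)), IsMinimalBasis P N →
    (Matrix.of fun (i : κ) (j : Sum (Fin p) (Fin 1)) =>
      Sum.elim (fun a => (N i a).eval lam0) (fun _ => (x i).eval lam0) j).rank = p + 1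

/-- `r 0, …, r (s-1)` is a `λ₀`-independent set of root polynomials of orders `k 0, …, k (s-1)`
for `P`: each is a root polynomial and `[N(λ₀) r₁(λ₀) … r_s(λ₀)]` has full column rank for
every right minimal basis `N`. -/
def IsIndepFamily {ι κ : Type*} [Fintype ι] [Fintype κ] (P : Matrix ι κ (Polynomial ℂ))
    (lam0 : ℂ) {s : ℕ} (k : Fin s → ℕ) (r : Fin s → κ → Polynomial ℂ) : Prop :=
  (∀ i, IsRootPoly P lam0 (k i) (r i)) ∧
  ∀ (p : ℕ) (N : Matrix κ (Fin p) (Polynomial ℂ)), IsMinimalBasis P N →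
    (Matrix.of fun (i : κ) (j : Sum (Fin p) (Fin s)) =>
      Sum.elim (fun a => (N i a).eval lam0) (fun b => (r b i).eval lam0) j).rank = p + s

/-- A complete set of root polynomials: a `λ₀`-independent set such that no `λ₀`-independent
set with more elements exists. -/
def IsCompleteFamily {ι κ : Type*} [Fintype ι] [Fintype κ] (P : Matrix ι κ (Polynomial ℂ))
    (lam0 : ℂ) {s : ℕ} (k : Fin s → ℕ) (r : Fin s → κ → Polynomial ℂ) : Prop :=
  IsIndepFamily P lam0 k r ∧
  ∀ (s' : ℕ) (k' : Fin s' → ℕ) (r' : Fin s' → κ → Polynomial ℂ),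
    IsIndepFamily P lam0 k' r' → s' ≤ s

/-- A maximal set of root polynomials at `λ₀`: complete, ordered (`k₁ ≥ … ≥ k_s > 0`), and for
every `j` there is no root polynomial of order `> k j` that stays `λ₀`-independent together
with `r₁, …, r_{j-1}`. -/
def IsMaximalFamily {ι κ : Type*} [Fintype ι] [Fintype κ] (P : Matrix ι κ (Polynomial ℂ))
    (lam0 : ℂ) {s : ℕ} (k : Fin s → ℕ) (r : Fin s → κ → Polynomial ℂ) : Prop :=
  IsCompleteFamily P lam0 k r ∧ Antitone k ∧ (∀ i, 0 < k i) ∧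
  ∀ (j : Fin s) (k' : ℕ), k j < k' → ∀ x : κ → Polynomial ℂ, IsRootPoly P lam0 k' x →
    ¬ ∀ (p : ℕ) (N : Matrix κ (Fin p) (Polynomial ℂ)), IsMinimalBasis P N →
      (Matrix.of fun (i : κ) (c : Sum (Fin p) (Fin ((j : ℕ) + 1))) =>
        Sum.elim (fun a => (N i a).eval lam0)
          (fun b => if h : (b : ℕ) < (j : ℕ) then (r ⟨(b : ℕ), h.trans j.isLt⟩ i).eval lam0
                    else (x i).eval lam0) c).rank = p + (j : ℕ) + 1

/-- `σ 0 ≤ … ≤ σ (r-1)` are the partial multiplicities of `P` at `λ₀`: there is a local Smith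
form `M(λ) P(λ) N(λ) = diag((λ-λ₀)^{σ i}) ⊕ 0` (up to positioning of the diagonal) with `M`,
`N` polynomial and invertible at `λ₀`. -/
def HasPartialMultiplicities {ι κ : Type*} [Fintype ι] [Fintype κ] [DecidableEq ι]
    [DecidableEq κ] (P : Matrix ι κ (Polynomial ℂ)) (lam0 : ℂ) {r : ℕ} (σ : Fin r → ℕ) : Prop :=
  Monotone σ ∧
  ∃ (M : Matrix ι ι (Polynomial ℂ)) (N : Matrix κ κ (Polynomial ℂ))
    (fR : Fin r → ι) (fC : Fin r → κ),
    Function.Injective fR ∧ Function.Injective fC ∧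
    (evalMat M lam0).det ≠ 0 ∧ (evalMat N lam0).det ≠ 0 ∧
    M * P * N = Matrix.of fun i j =>
      ∑ a : Fin r, if i = fR a ∧ j = fC a then (Polynomial.X - Polynomial.C lam0) ^ σ a else 0

/-- The values at `μ` of the polynomial vectors `x` such that `q` divides every entry of `P x`. -/
def valueSpace {ι κ : Type*} [Fintype κ] (P : Matrix ι κ ℂ[X]) (μ : ℂ) (q : ℂ[X]) :
    Submodule ℂ (κ → ℂ) where
  carrier := {v | ∃ x : κ → ℂ[X], (∀ i, q ∣ P.mulVec x i) ∧ (fun j => (x j).eval μ) = v}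
  zero_mem' := ⟨0, by simp, by ext; simp⟩
  add_mem' := by
    rintro _ _ ⟨x, hx, rfl⟩ ⟨y, hy, rfl⟩
    refine ⟨x + y, fun i => ?_, by ext; simp⟩
    rw [Matrix.mulVec_add]
    exact dvd_add (hx i) (hy i)
  smul_mem' := by
    rintro c _ ⟨x, hx, rfl⟩
    refine ⟨C c • x, fun i => ?_, by ext; simp⟩
    rw [Matrix.mulVec_smul]
    exact (hx i).mul_left _

section

variable {ι κ : Type*} [Fintype κ] {P : Matrix ι κ ℂ[X]} {μ : ℂ}

theorem valueSpace_le_of_dvd {p q : ℂ[X]} (h : p ∣ q) : valueSpace P μ q ≤ valueSpace P μ p := by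
  rintro v ⟨x, hx, rfl⟩
  exact ⟨x, fun i => h.trans (hx i), rfl⟩

theorem mem_rightNullspace_algebraMap {x : κ → ℂ[X]} :
    (fun j => algebraMap ℂ[X] (RatFunc ℂ) (x j)) ∈ rightNullspace P ↔ P.mulVec x = 0 := by
  have key : (toRat P).mulVec (fun j => algebraMap ℂ[X] (RatFunc ℂ) (x j))
      = fun i => algebraMap ℂ[X] (RatFunc ℂ) (P.mulVec x i) := by
    funext i
    exact ((algebraMap ℂ[X] (RatFunc ℂ)).map_mulVec P x i).symm
  rw [rightNullspace, LinearMap.mem_ker, Matrix.mulVecLin_apply, key, funext_iff, funext_iff]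
  simp

end

section

variable {ι κ : Type*} [Fintype ι] [Fintype κ] {P : Matrix ι κ ℂ[X]} {μ : ℂ}

theorem eq_pow_mul_eval_ne_zero {q : ℂ[X]} (hq : q ≠ 0) (μ : ℂ) :
    ∃ (m : ℕ) (q' : ℂ[X]), q = (X - C μ) ^ m * q' ∧ q'.eval μ ≠ 0 := by
  obtain ⟨q', h, h'⟩ := exists_eq_pow_rootMultiplicity_mul_and_not_dvd q hq μ
  exact ⟨_, q', h, fun h0 => h' (dvd_iff_isRoot.2 h0)⟩

theorem exists_isMinimalBasis (P : Matrix ι κ ℂ[X]) :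
    ∃ (p : ℕ) (N : Matrix κ (Fin p) ℂ[X]), IsMinimalBasis P N := by
  classical
  let p := Module.finrank (RatFunc ℂ) (rightNullspace P)
  let S : Set (Matrix κ (Fin p) ℂ[X]) := {M |
    LinearIndependent (RatFunc ℂ) (fun j : Fin p => fun i : κ => toRat M i j) ∧
    Submodule.span (RatFunc ℂ) (Set.range fun j : Fin p => fun i : κ => toRat M i j)
      = rightNullspace P}
  have hS : S.Nonempty := by
    let b := Module.finBasis (RatFunc ℂ) (rightNullspace P)
    obtain ⟨q, hq⟩ := IsLocalization.exist_integer_multiples_of_finite (nonZeroDivisors ℂ[X])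
      (fun ij : κ × Fin p => (b ij.2 : κ → RatFunc ℂ) ij.1)
    choose M hM using hq
    have hq0 : algebraMap ℂ[X] (RatFunc ℂ) q ≠ 0 := by simp
    let b' := b.unitsSMul fun _ => Units.mk0 _ hq0
    have hcol : (fun j : Fin p => fun i : κ => toRat (Matrix.of fun i j => M (i, j)) i j)
        = (rightNullspace P).subtype ∘ b' := by
      funext j i
      have := hM (i, j)
      simp only [toRat, Matrix.map_apply, Matrix.of_apply, this, Function.comp_apply, b',
        Module.Basis.unitsSMul_apply, Units.smul_def, Units.val_mk0, Algebra.smul_def]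
      rfl
    refine ⟨Matrix.of fun i j => M (i, j), ?_, ?_⟩
    · rw [hcol]
      exact b'.linearIndependent.map' _ (Submodule.ker_subtype _)
    · rw [hcol, Set.range_comp, Submodule.span_image, b'.span_eq, Submodule.map_top,
        Submodule.range_subtype]
  let f : Matrix κ (Fin p) ℂ[X] → ℕ := fun M => ∑ j, colDegree fun i => M i j
  refine ⟨p, Function.argminOn f S hS, (Function.argminOn_mem f S hS).1,
    (Function.argminOn_mem f S hS).2, fun M h1 h2 => Function.argminOn_le f S ⟨h1, h2⟩⟩

theorem IsMinimalBasis.mulVec_col {p : ℕ} {N : Matrix κ (Fin p) ℂ[X]} (hN : IsMinimalBasis P N)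
    (j : Fin p) : P.mulVec (fun i => N i j) = 0 := by
  rw [← mem_rightNullspace_algebraMap, ← hN.2.1]
  exact Submodule.subset_span ⟨j, rfl⟩

theorem IsMinimalBasis.linearIndependent_eval {p : ℕ} {N : Matrix κ (Fin p) ℂ[X]}
    (hN : IsMinimalBasis P N) (μ : ℂ) :
    LinearIndependent ℂ (fun j : Fin p => fun i : κ => (N i j).eval μ) := by
  classical
  by_contra hdep
  obtain ⟨c, hc, j₁, hj₁⟩ := Fintype.not_linearIndependent_iff.1 hdep
  obtain ⟨j₀, hj₀, hmax⟩ := Finset.exists_max_image (Finset.univ.filter fun j => c j ≠ 0)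
    (fun j => colDegree fun i => N i j) ⟨j₁, by simpa using hj₁⟩
  simp only [Finset.mem_filter, Finset.mem_univ, true_and] at hj₀ hmax
  set D := colDegree fun i => N i j₀ with hD
  let w : κ → ℂ[X] := fun i => ∑ j, C (c j) * N i j
  have hwdeg (i : κ) : (w i).natDegree ≤ D := by
    refine natDegree_sum_le_of_forall_le _ _ fun j _ => ?_
    by_cases hcj : c j = 0
    · simp [hcj]
    · exact (natDegree_C_mul_le _ _).trans
        ((Finset.le_sup (f := fun i => (N i j).natDegree) (Finset.mem_univ i)).trans (hmax j hcj))
  have hwdvd (i : κ) : X - C μ ∣ w i := by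
    rw [dvd_iff_isRoot, IsRoot.def]
    simpa [w, eval_finsetSum] using congrFun hc i
  choose w' hw' using hwdvd
  have hwP : P.mulVec w = 0 := by
    have : w = ∑ j, C (c j) • fun i => N i j := by
      ext1 i
      simp [w]
    rw [this, Matrix.mulVec_sum]
    exact Finset.sum_eq_zero fun j _ => by rw [Matrix.mulVec_smul, hN.mulVec_col, smul_zero]
  have hw'P : P.mulVec w' = 0 := by
    have h : w = (X - C μ) • w' := funext hw'
    rw [h, Matrix.mulVec_smul] at hwP
    exact (smul_eq_zero.1 hwP).resolve_left (X_sub_C_ne_zero μ)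
  have hwrat : (fun i => algebraMap ℂ[X] (RatFunc ℂ) (w i))
      = ∑ j, algebraMap ℂ[X] (RatFunc ℂ) (C (c j)) • fun i => toRat N i j := by
    ext1 i
    simp [w, toRat]
  have hw0 : w ≠ 0 := by
    intro h0
    rw [h0] at hwrat
    have := Fintype.linearIndependent_iff.1 hN.1 _
      (hwrat.symm.trans (by ext1 i; simp)) j₀
    simp [hj₀] at this
  have hsucc (i : κ) (hi : w' i ≠ 0) : (w' i).natDegree + 1 ≤ D := by
    have := hwdeg i
    rw [hw' i, natDegree_mul (X_sub_C_ne_zero μ) hi, natDegree_X_sub_C] at this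
    omega
  have hDpos : 0 < D := by
    obtain ⟨i, hi⟩ := Function.ne_iff.1 hw0
    have := hsucc i (fun h => hi (by simp [hw' i, h]))
    omega
  have hdeglt : colDegree w' < D := by
    refine (Finset.sup_lt_iff hDpos).2 fun i _ => ?_
    by_cases hi : w' i = 0
    · simpa [hi] using hDpos
    · exact hsucc i hi
  let M := N.updateCol j₀ w'
  have hMcol (j : Fin p) : (fun i => M i j) = if j = j₀ then w' else fun i => N i j := by
    ext1 i
    by_cases h : j = j₀ <;> simp [M, h]
  have hMrat (j : Fin p) : (fun i => toRat M i j)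
      = fun i => algebraMap ℂ[X] (RatFunc ℂ) ((if j = j₀ then w' else fun i => N i j) i) := by
    rw [← hMcol]; rfl
  have hspan : Submodule.span (RatFunc ℂ) (Set.range fun j : Fin p => fun i : κ => toRat M i j)
      = rightNullspace P := by
    apply le_antisymm
    · rw [Submodule.span_le]
      rintro _ ⟨j, rfl⟩
      simp only [hMrat]
      refine mem_rightNullspace_algebraMap.2 ?_
      split_ifs
      · exact hw'P
      · exact hN.mulVec_col j
    · have hmem (j : Fin p) (hj : j ≠ j₀) : (fun i => toRat N i j) ∈ Submodule.span (RatFunc ℂ)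
          (Set.range fun j : Fin p => fun i : κ => toRat M i j) := by
        refine Submodule.subset_span ⟨j, ?_⟩
        simp only [hMrat, if_neg hj]
        rfl
      rw [← hN.2.1, Submodule.span_le]
      rintro _ ⟨j, rfl⟩
      by_cases hj : j = j₀
      · subst hj
        have hw'mem : (fun i => algebraMap ℂ[X] (RatFunc ℂ) (w i)) ∈ Submodule.span (RatFunc ℂ)
            (Set.range fun j : Fin p => fun i : κ => toRat M i j) := by
          have : (fun i => algebraMap ℂ[X] (RatFunc ℂ) (w i))
              = algebraMap ℂ[X] (RatFunc ℂ) (X - C μ) • fun i => toRat M i j := by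
            rw [hMrat, if_pos rfl]
            ext1 i
            rw [hw', map_mul]; rfl
          rw [this]
          exact Submodule.smul_mem _ _ (Submodule.subset_span ⟨j, rfl⟩)
        rw [hwrat, ← Finset.add_sum_erase _ _ (Finset.mem_univ j)] at hw'mem
        have hrest := Submodule.sum_mem _ fun i (hi : i ∈ Finset.univ.erase j) =>
          Submodule.smul_mem _ (algebraMap ℂ[X] (RatFunc ℂ) (C (c i)))
            (hmem i (Finset.ne_of_mem_erase hi))
        have := (Submodule.add_mem_iff_left _ hrest).1 hw'mem
        have hcj : algebraMap ℂ[X] (RatFunc ℂ) (C (c j)) ≠ 0 := by simpa using hj₀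
        exact (Submodule.smul_mem_iff _ hcj).1 this
      · exact hmem j hj
  have hli : LinearIndependent (RatFunc ℂ) (fun j : Fin p => fun i : κ => toRat M i j) := by
    rw [linearIndependent_iff_card_eq_finrank_span, Set.finrank, hspan, ← hN.2.1]
    exact (finrank_span_eq_card hN.1).symm
  refine absurd (hN.2.2 M hli hspan) (not_le.2 (Finset.sum_lt_sum (fun j _ => ?_)
    ⟨j₀, Finset.mem_univ _, ?_⟩))
  · rw [hMcol]
    split_ifs with h
    · rw [h]; exact hdeglt.le
    · exact le_rfl
  · rw [hMcol, if_pos rfl]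
    exact hdeglt

theorem IsMinimalBasis.span_eval {p : ℕ} {N : Matrix κ (Fin p) ℂ[X]}
    (hN : IsMinimalBasis P N) (μ : ℂ) :
    Submodule.span ℂ (Set.range fun j : Fin p => fun i : κ => (N i j).eval μ)
      = valueSpace P μ 0 := by
  apply le_antisymm
  · rw [Submodule.span_le]
    rintro _ ⟨j, rfl⟩
    exact ⟨fun i => N i j, fun i => by simp [hN.mulVec_col], rfl⟩
  rintro _ ⟨x, hx, rfl⟩
  have hx0 : P.mulVec x = 0 := funext fun i => zero_dvd_iff.1 (hx i)
  rw [← mem_rightNullspace_algebraMap, ← hN.2.1, Submodule.mem_span_range_iff_exists_fun] at hx0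
  obtain ⟨c, hc⟩ := hx0
  obtain ⟨q, hq⟩ := IsLocalization.exist_integer_multiples_of_finite (nonZeroDivisors ℂ[X]) c
  choose d hd using hq
  have hqd (i : κ) : q * x i = ∑ j, d j * N i j := by
    apply RatFunc.algebraMap_injective ℂ
    simp only [map_mul, map_sum, hd]
    rw [← congrFun hc i, Finset.sum_apply, Finset.mul_sum]
    refine Finset.sum_congr rfl fun j _ => ?_
    simp only [toRat, Matrix.map_apply, Pi.smul_apply, smul_eq_mul, Algebra.smul_def]
    exact (mul_assoc _ _ _).symm
  obtain ⟨m, q', hq', hq'0⟩ := eq_pow_mul_eval_ne_zero (nonZeroDivisors.ne_zero q.2) μ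
  have hred : ∀ (m : ℕ) (d : Fin p → ℂ[X]),
      (∀ i, (X - C μ) ^ m * q' * x i = ∑ j, d j * N i j) →
      ∃ d' : Fin p → ℂ[X], ∀ i, q' * x i = ∑ j, d' j * N i j := by
    intro m
    induction m with
    | zero => exact fun d h => ⟨d, by simpa using h⟩
    | succ m ih =>
      intro d h
      have hroot (j : Fin p) : X - C μ ∣ d j := by
        rw [dvd_iff_isRoot]
        refine Fintype.linearIndependent_iff.1 (hN.linearIndependent_eval μ)
          (fun j => (d j).eval μ) ?_ j
        ext1 i
        simpa [eval_finsetSum] using (congrArg (eval μ) (h i)).symm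
      choose d' hd' using hroot
      refine ih d' fun i => mul_left_cancel₀ (X_sub_C_ne_zero μ) ?_
      rw [Finset.mul_sum, ← mul_assoc, ← mul_assoc, ← pow_succ', h i]
      exact Finset.sum_congr rfl fun j _ => by rw [hd' j, mul_assoc]
  obtain ⟨d', hd'⟩ := hred m d fun i => by rw [← hq']; exact hqd i
  rw [← Submodule.smul_mem_iff _ hq'0, Submodule.mem_span_range_iff_exists_fun]
  refine ⟨fun j => (d' j).eval μ, ?_⟩
  ext1 i
  simpa [eval_finsetSum] using (congrArg (eval μ) (hd' i)).symm

theorem forall_rank_eq_iff {s : ℕ} (P : Matrix ι κ ℂ[X]) (μ : ℂ) (w : Fin s → κ → ℂ) :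
    (∀ (p : ℕ) (N : Matrix κ (Fin p) ℂ[X]), IsMinimalBasis P N →
      (Matrix.of fun (i : κ) (j : Sum (Fin p) (Fin s)) =>
        Sum.elim (fun a => (N i a).eval μ) (fun b => w b i) j).rank = p + s) ↔
      LinearIndependent ℂ ((valueSpace P μ 0).mkQ ∘ w) := by
  have key (p : ℕ) (N : Matrix κ (Fin p) ℂ[X]) (hN : IsMinimalBasis P N) :
      (Matrix.of fun (i : κ) (j : Sum (Fin p) (Fin s)) =>
        Sum.elim (fun a => (N i a).eval μ) (fun b => w b i) j).rank = p + s ↔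
      LinearIndependent ℂ ((valueSpace P μ 0).mkQ ∘ w) := by
    have hcol : (Matrix.of fun (i : κ) (j : Sum (Fin p) (Fin s)) =>
        Sum.elim (fun a => (N i a).eval μ) (fun b => w b i) j).col
        = Sum.elim (fun j i => (N i j).eval μ) w := by
      ext j i
      cases j <;> rfl
    have hcard : p + s = Fintype.card (Fin p ⊕ Fin s) := by simp
    rw [Matrix.rank_eq_finrank_span_cols, hcol, hcard, eq_comm, ← Set.finrank,
      ← linearIndependent_iff_card_eq_finrank_span, linearIndependent_sum, Sum.elim_comp_inl,
      Sum.elim_comp_inr, hN.span_eval]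
    constructor
    · rintro ⟨-, h, hdis⟩
      exact (LinearMap.linearIndependent_iff_of_disjoint _
        (by rwa [Submodule.ker_mkQ, disjoint_comm])).2 h
    · intro h
      have hdis := Submodule.range_ker_disjoint h
      refine ⟨hN.linearIndependent_eval μ,
        (LinearMap.linearIndependent_iff_of_disjoint _ hdis).1 h, ?_⟩
      rwa [Submodule.ker_mkQ, disjoint_comm] at hdis
  constructor
  · intro h
    obtain ⟨p, N, hN⟩ := exists_isMinimalBasis P
    exact (key p N hN).1 (h p N hN)
  · exact fun h p N hN => (key p N hN).2 h

end

/-- The maximality condition on a linearly independent family adapted to a decreasing chain of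
subspaces amounts to the equality of dimension counts. -/
theorem forall_le_span_iff_forall_card_eq_finrank {V : Type*} [AddCommGroup V] [Module ℂ V]
    [FiniteDimensional ℂ V] {U : ℕ → Submodule ℂ V} {s : ℕ}
    (hUs : ∀ l, Module.finrank ℂ (U l) ≤ s) {k : Fin s → ℕ} (hk : Antitone k) {u : Fin s → V}
    (hu : LinearIndependent ℂ u) (hmem : ∀ i l, l < k i → u i ∈ U l) :
    (∀ (j : Fin s) (l : ℕ), k j ≤ l →
        U l ≤ Submodule.span ℂ (Set.range fun i : Fin j => u (Fin.castLE j.isLt.le i))) ↔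
      ∀ l, (Finset.univ.filter fun i => l < k i).card = Module.finrank ℂ (U l) := by
  have hle (l : ℕ) :
      Submodule.span ℂ (Set.range fun i : {i // l < k i} => u i) ≤ U l := by
    rw [Submodule.span_le]
    rintro _ ⟨i, rfl⟩
    exact hmem _ _ i.2
  have hfin (l : ℕ) : Module.finrank ℂ
      (Submodule.span ℂ (Set.range fun i : {i // l < k i} => u i))
      = (Finset.univ.filter fun i => l < k i).card := by
    rw [← Fintype.card_subtype]
    exact finrank_span_eq_card (hu.comp _ Subtype.val_injective)
  constructor
  · intro h l
    refine le_antisymm ((hfin l).symm.le.trans (Submodule.finrank_mono (hle l))) ?_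
    by_contra! hlt
    have hjs := hlt.trans_le (hUs l)
    set j : Fin s := ⟨_, hjs⟩ with hj
    have hkj : k j ≤ l := by
      by_contra! hlj
      have hsub : Finset.Iic j ⊆ Finset.univ.filter fun i => l < k i := fun i hi => by
        simpa using hlj.trans_le (hk (Finset.mem_Iic.1 hi))
      have := Finset.card_le_card hsub
      rw [Fin.card_Iic] at this
      simp only [hj] at this
      omega
    have h1 := Submodule.finrank_mono (h j l hkj)
    have h2 := finrank_span_eq_card (hu.comp _ (Fin.castLE_injective j.isLt.le))
    rw [Fintype.card_fin] at h2
    exact absurd hlt (not_lt.2 (h1.trans h2.le))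
  · intro h j l hjl
    rw [← Submodule.eq_of_le_of_finrank_eq (hle l) ((hfin l).trans (h l))]
    refine Submodule.span_mono ?_
    rintro _ ⟨⟨i, hi⟩, rfl⟩
    have hij : i < j := by
      by_contra! hji
      exact absurd (hi.trans_le (hk hji)) (not_lt.2 hjl)
    exact ⟨⟨i, hij⟩, rfl⟩

theorem sum_eq_sum_range_card_lt {α : Type*} [Fintype α] (f : α → ℕ) {L : ℕ}
    (h : ∀ a, f a ≤ L) :
    ∑ a, f a = ∑ l ∈ Finset.range L, (Finset.univ.filter fun a => l < f a).card := by
  simp only [Finset.card_filter]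
  rw [Finset.sum_comm]
  refine Finset.sum_congr rfl fun a _ => ?_
  rw [← Finset.card_filter]
  have : (Finset.range L).filter (fun l => l < f a) = Finset.range (f a) := by
    ext l
    have := h a
    simp only [Finset.mem_filter, Finset.mem_range]
    omega
  rw [this, Finset.card_range]

theorem forall_card_lt_eq_iff_sum_eq {α β : Type*} [Fintype α] [Fintype β] {f : α → ℕ} {g : β → ℕ}
    (h : ∀ l, (Finset.univ.filter fun a => l < f a).card
      ≤ (Finset.univ.filter fun b => l < g b).card) :
    (∀ l, (Finset.univ.filter fun a => l < f a).card
      = (Finset.univ.filter fun b => l < g b).card) ↔ ∑ a, f a = ∑ b, g b := by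
  have key (L : ℕ) (hL : (∑ a, f a) + ∑ b, g b ≤ L) : ∑ a, f a = ∑ b, g b ↔
      ∀ l ∈ Finset.range L, (Finset.univ.filter fun a => l < f a).card
        = (Finset.univ.filter fun b => l < g b).card := by
    have hf (a : α) : f a ≤ L :=
      ((Finset.single_le_sum (fun _ _ => Nat.zero_le _) (Finset.mem_univ a)).trans
        (Nat.le_add_right _ _)).trans hL
    have hg (b : β) : g b ≤ L :=
      ((Finset.single_le_sum (fun _ _ => Nat.zero_le _) (Finset.mem_univ b)).trans
        (Nat.le_add_left _ _)).trans hL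
    rw [sum_eq_sum_range_card_lt f hf, sum_eq_sum_range_card_lt g hg]
    exact Finset.sum_eq_sum_iff_of_le fun l _ => h l
  refine ⟨fun H => (key _ le_rfl).2 fun l _ => H l, fun H l => ?_⟩
  exact (key ((∑ a, f a) + (∑ b, g b) + (l + 1)) (Nat.le_add_right _ _)).1 H l
    (Finset.mem_range.2 (by omega))

theorem card_eq_add_card_lt {γ : Type*} [Fintype γ] (e : γ → ℕ) (l : ℕ) :
    (Finset.univ.filter fun c => l + 1 = e c).card + (Finset.univ.filter fun c => l + 1 < e c).card
      = (Finset.univ.filter fun c => l < e c).card := by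
  classical
  rw [← Finset.card_union_of_disjoint]
  · congr 1
    ext c
    simp only [Finset.mem_union, Finset.mem_filter, Finset.mem_univ, true_and]
    omega
  · rw [Finset.disjoint_filter]
    intro c _ h
    omega

theorem forall_card_lt_eq_iff_multiset_map_eq {α β : Type*} [Fintype α] [Fintype β] {f : α → ℕ}
    {g : β → ℕ} (hf : ∀ a, 0 < f a) :
    (∀ l, (Finset.univ.filter fun a => l < f a).card
      = (Finset.univ.filter fun b => l < g b).card) ↔
    Multiset.map f Finset.univ.val
      = Multiset.map g ((Finset.univ.filter fun b => 0 < g b).val) := by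
  constructor
  · intro h
    ext l
    rw [Multiset.count_map, Multiset.count_map]
    change (Finset.univ.filter fun a => l = f a).card
      = ((Finset.univ.filter fun b => 0 < g b).filter fun b => l = g b).card
    rw [Finset.filter_filter]
    rcases l with _ | l
    · rw [Finset.card_eq_zero.2, Finset.card_eq_zero.2]
      · rw [Finset.filter_eq_empty_iff]
        intro b _
        omega
      · rw [Finset.filter_eq_empty_iff]
        intro a _
        have := hf a
        omega
    · have h1 : (fun b => 0 < g b ∧ l + 1 = g b) = fun b => l + 1 = g b := by
        funext b
        exact propext ⟨fun h => h.2, fun h => ⟨by omega, h⟩⟩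
      have h2 := card_eq_add_card_lt f l
      have h3 := card_eq_add_card_lt g l
      have h4 := h l
      have h5 := h (l + 1)
      simp only [h1]
      omega
  · intro h l
    have h1 := congrArg (Multiset.countP fun n => l < n) h
    rw [Multiset.countP_map, Multiset.countP_map] at h1
    refine h1.trans ?_
    change ((Finset.univ.filter fun b => 0 < g b).filter fun b => l < g b).card = _
    rw [Finset.filter_filter]
    congr 1
    ext b
    simp only [Finset.mem_filter, Finset.mem_univ, true_and]
    omega

theorem det_evalMat {κ : Type*} [Fintype κ] [DecidableEq κ] (M : Matrix κ κ ℂ[X]) (μ : ℂ) :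
    (evalMat M μ).det = M.det.eval μ :=
  ((evalRingHom μ).map_det M).symm

theorem evalMat_mulVec {ι κ : Type*} [Fintype κ] (M : Matrix ι κ ℂ[X]) (μ : ℂ) (x : κ → ℂ[X]) :
    (evalMat M μ).mulVec (fun j => (x j).eval μ) = fun i => (M.mulVec x i).eval μ :=
  funext fun i => ((evalRingHom μ).map_mulVec M x i).symm

theorem smith_mulVec_apply {ι κ : Type*} [Fintype κ] [DecidableEq ι] [DecidableEq κ] {r : ℕ}
    (d : Fin r → ℂ[X]) (fR : Fin r → ι) (fC : Fin r → κ)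
    (y : κ → ℂ[X]) (i : ι) :
    (Matrix.of fun i j => ∑ a : Fin r, if i = fR a ∧ j = fC a then d a else 0).mulVec y i
      = ∑ a, if i = fR a then d a * y (fC a) else 0 := by
  simp only [Matrix.mulVec, dotProduct, Matrix.of_apply, Finset.sum_mul]
  rw [Finset.sum_comm]
  refine Finset.sum_congr rfl fun a _ => ?_
  by_cases h : i = fR a <;> simp [h]

section

variable {ι κ : Type*} [Fintype ι] [Fintype κ] [DecidableEq ι] [DecidableEq κ]
  {P : Matrix ι κ ℂ[X]} {μ : ℂ}

/-- A local Smith form diagonalises the value spaces. -/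
theorem finrank_valueSpace_add_card {r : ℕ} {σ : Fin r → ℕ} (hσ : HasPartialMultiplicities P μ σ)
    {q : ℂ[X]} (hcancel : ∀ b c : ℂ[X], b.eval μ ≠ 0 → q ∣ b * c → q ∣ c)
    (hroot : ∀ (e : ℕ) (c : ℂ[X]), ¬ q ∣ (X - C μ) ^ e → q ∣ (X - C μ) ^ e * c → c.eval μ = 0)
    [DecidablePred fun a => ¬ q ∣ (X - C μ) ^ σ a] :
    Module.finrank ℂ (valueSpace P μ q)
      + (Finset.univ.filter fun a => ¬ q ∣ (X - C μ) ^ σ a).card = Fintype.card κ := by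
  obtain ⟨-, M, N, fR, fC, hfR, hfC, hM, hN, hD⟩ := hσ
  rw [det_evalMat] at hM
  have hinj : Function.Injective (evalMat N μ).mulVecLin :=
    Matrix.mulVec_injective_iff_isUnit.2 ((Matrix.isUnit_iff_isUnit_det _).2 hN.isUnit)
  let S : Finset κ := (Finset.univ.filter fun a => ¬ q ∣ (X - C μ) ^ σ a).image fC
  let W : Submodule ℂ (κ → ℂ) := ⨅ j ∈ (S : Set κ), LinearMap.ker (LinearMap.proj j)
  have hW (y : κ → ℂ) : y ∈ W ↔ ∀ a, ¬ q ∣ (X - C μ) ^ σ a → y (fC a) = 0 := by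
    simp [W, S, Submodule.mem_iInf]
  have hfinW : Module.finrank ℂ W = Sᶜ.card := by
    have e := LinearMap.iInfKerProjEquiv ℂ (fun _ : κ => ℂ) (I := ((Sᶜ : Finset κ) : Set κ))
      (J := (S : Set κ)) (by rw [Finset.coe_compl]; exact disjoint_compl_left)
      (by rw [Finset.coe_compl, Set.compl_union_self])
    rw [e.finrank_eq, Module.finrank_fintype_fun_eq_card]
    exact Fintype.card_coe _
  have hmulD (x : κ → ℂ[X]) (i : ι) : M.mulVec (P.mulVec (N.mulVec x)) i
      = ∑ a, if i = fR a then (X - C μ) ^ σ a * x (fC a) else 0 := by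
    rw [Matrix.mulVec_mulVec, Matrix.mulVec_mulVec, hD, smith_mulVec_apply]
  have hmap : valueSpace P μ q = W.map (evalMat N μ).mulVecLin := by
    ext v
    rw [Submodule.mem_map]
    constructor
    · rintro ⟨x, hx, rfl⟩
      rw [det_evalMat] at hN
      have hNy : N.mulVec (N.adjugate.mulVec x) = N.det • x := by
        rw [Matrix.mulVec_mulVec, Matrix.mul_adjugate, Matrix.smul_mulVec, Matrix.one_mulVec]
      refine ⟨(N.det.eval μ)⁻¹ • fun j => (N.adjugate.mulVec x j).eval μ, ?_, ?_⟩
      · refine W.smul_mem _ ((hW _).2 fun a ha => hroot _ _ ha ?_)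
        have h := hmulD (N.adjugate.mulVec x) (fR a)
        rw [Finset.sum_eq_single a (fun b _ hb => if_neg fun h => hb (hfR h).symm) (by simp),
          if_pos rfl] at h
        rw [← h, hNy, Matrix.mulVec_smul, Matrix.mulVec_smul]
        exact (Finset.dvd_sum fun i _ => (hx i).mul_left _).mul_left _
      · rw [map_smul, Matrix.mulVecLin_apply, evalMat_mulVec, hNy]
        ext1 j
        simp [hN]
    · rintro ⟨y, hy, rfl⟩
      rw [hW] at hy
      refine ⟨N.mulVec fun j => C (y j), fun i => hcancel M.det _ hM ?_, ?_⟩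
      · have hadj : M.adjugate.mulVec (M.mulVec (P.mulVec (N.mulVec fun j => C (y j)))) i
            = M.det * P.mulVec (N.mulVec fun j => C (y j)) i := by
          rw [Matrix.mulVec_mulVec, Matrix.adjugate_mul, Matrix.smul_mulVec, Matrix.one_mulVec]
          rfl
        rw [← hadj]
        refine Finset.dvd_sum fun i' _ => Dvd.dvd.mul_left ?_ _
        rw [hmulD]
        refine Finset.dvd_sum fun a _ => ?_
        split_ifs
        · by_cases ha : q ∣ (X - C μ) ^ σ a
          · exact ha.mul_right _
          · simp [hy a ha]
        · exact dvd_zero _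
      · rw [Matrix.mulVecLin_apply, ← evalMat_mulVec]
        simp
  rw [hmap, ← (Submodule.equivMapOfInjective _ hinj W).finrank_eq, hfinW,
    ← Finset.card_image_of_injective _ hfC]
  exact Finset.card_compl_add_card S

theorem finrank_map_mkQ_valueSpace {r : ℕ} {σ : Fin r → ℕ} (hσ : HasPartialMultiplicities P μ σ)
    (l : ℕ) :
    Module.finrank ℂ ((valueSpace P μ ((X - C μ) ^ (l + 1))).map (valueSpace P μ 0).mkQ)
      = (Finset.univ.filter fun a => l < σ a).card := by
  classical
  have hprime : Prime (X - C μ) := prime_X_sub_C μ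
  have h0 := finrank_valueSpace_add_card hσ (q := 0)
    (fun b c hb h => by
      rw [zero_dvd_iff] at h ⊢
      exact (mul_eq_zero.1 h).resolve_left fun hb0 => hb (by simp [hb0]))
    (fun e c _ h => by
      rw [zero_dvd_iff] at h
      simp [(mul_eq_zero.1 h).resolve_left (pow_ne_zero _ hprime.ne_zero)])
  have hl := finrank_valueSpace_add_card hσ (q := (X - C μ) ^ (l + 1))
    (fun b c hb h => hprime.pow_dvd_of_dvd_mul_left _ (fun hb0 => hb (dvd_iff_isRoot.1 hb0)) h)
    (fun e c he h => by
      by_contra hc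
      exact he (hprime.pow_dvd_of_dvd_mul_right _ (fun hc0 => hc (dvd_iff_isRoot.1 hc0)) h))
  have hS0 : (Finset.univ.filter fun a => ¬ (0 : ℂ[X]) ∣ (X - C μ) ^ σ a) = Finset.univ := by
    refine Finset.filter_true_of_mem fun a _ => ?_
    rw [zero_dvd_iff]
    exact pow_ne_zero _ hprime.ne_zero
  have hSl : (Finset.univ.filter fun a => ¬ (X - C μ) ^ (l + 1) ∣ (X - C μ) ^ σ a)
      = Finset.univ.filter fun a => ¬ l < σ a := by
    refine Finset.filter_congr fun a _ => ?_
    rw [pow_dvd_pow_iff hprime.ne_zero hprime.not_isUnit, Nat.succ_le_iff]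
  rw [hS0] at h0
  rw [hSl] at hl
  have hcard := Finset.card_filter_add_card_filter_not (s := Finset.univ) fun a => l < σ a
  have hle : valueSpace P μ 0 ≤ valueSpace P μ ((X - C μ) ^ (l + 1)) :=
    valueSpace_le_of_dvd (dvd_zero _)
  have hrank := LinearMap.finrank_range_add_finrank_ker
    ((valueSpace P μ 0).mkQ.domRestrict (valueSpace P μ ((X - C μ) ^ (l + 1))))
  rw [LinearMap.range_domRestrict, LinearMap.ker_domRestrict, Submodule.ker_mkQ,
    (Submodule.comapSubtypeEquivOfLe hle).finrank_eq] at hrank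
  omega

end

section

variable {ι κ : Type*} [Fintype ι] [Fintype κ] {P : Matrix ι κ ℂ[X]} {μ : ℂ}

theorem IsRootPoly.mkQ_mem {k l : ℕ} {x : κ → ℂ[X]} (hx : IsRootPoly P μ k x) (hl : l < k) :
    (valueSpace P μ 0).mkQ (fun i => (x i).eval μ)
      ∈ (valueSpace P μ ((X - C μ) ^ (l + 1))).map (valueSpace P μ 0).mkQ :=
  Submodule.mem_map_of_mem ⟨x, fun i => (pow_dvd_pow _ hl).trans (hx.1.2.2.1 i), rfl⟩

theorem exists_isRootPoly_of_mem {l : ℕ} {z : (κ → ℂ) ⧸ valueSpace P μ 0}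
    (hz : z ∈ (valueSpace P μ ((X - C μ) ^ (l + 1))).map (valueSpace P μ 0).mkQ) (hz0 : z ≠ 0) :
    ∃ (k : ℕ) (x : κ → ℂ[X]), l < k ∧ IsRootPoly P μ k x ∧
      (valueSpace P μ 0).mkQ (fun i => (x i).eval μ) = z := by
  classical
  obtain ⟨_, ⟨x, hx, rfl⟩, rfl⟩ := hz
  have hmem : (fun i => (x i).eval μ) ∉ valueSpace P μ 0 := fun h =>
    hz0 ((Submodule.Quotient.mk_eq_zero _).2 h)
  have hex : ∃ e, ¬ ∀ i, (X - C μ) ^ e ∣ P.mulVec x i := by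
    by_contra! h
    refine hmem ⟨x, fun i => zero_dvd_iff.2 ?_, rfl⟩
    by_contra h0
    obtain ⟨e, he⟩ := finiteMultiplicity_X_sub_C μ h0
    exact he (h _ i)
  obtain ⟨k, hk⟩ : ∃ k, Nat.find hex = k + 1 :=
    Nat.exists_eq_succ_of_ne_zero fun h => by
      have := Nat.find_spec hex
      rw [h] at this
      simp at this
  have hspec := Nat.find_spec hex
  rw [hk] at hspec
  have hdvd : ∀ i, (X - C μ) ^ k ∣ P.mulVec x i := not_not.1 (Nat.find_min hex (by omega))
  have hlk : l < k := by
    by_contra! hkl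
    exact hspec fun i => (pow_dvd_pow _ (by omega)).trans (hx i)
  refine ⟨k, x, hlk, ⟨⟨by omega, fun h => hmem (h ▸ Submodule.zero_mem _), hdvd, hspec⟩, ?_⟩, rfl⟩
  refine (forall_rank_eq_iff P μ fun _ : Fin 1 => fun i => (x i).eval μ).2 ?_
  rw [linearIndependent_unique_iff]
  exact hz0

theorem isMaximalFamily_iff {s : ℕ} {k : Fin s → ℕ} {r : Fin s → κ → ℂ[X]}
    (hr : IsCompleteFamily P μ k r) (hk : Antitone k) (hpos : ∀ i, 0 < k i) :
    IsMaximalFamily P μ k r ↔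
      ∀ (j : Fin s) (l : ℕ), k j ≤ l →
        (valueSpace P μ ((X - C μ) ^ (l + 1))).map (valueSpace P μ 0).mkQ ≤
          Submodule.span ℂ (Set.range fun i : Fin j =>
            (valueSpace P μ 0).mkQ fun c => (r (Fin.castLE j.isLt.le i) c).eval μ) := by
  have hli : LinearIndependent ℂ fun i => (valueSpace P μ 0).mkQ fun c => (r i c).eval μ :=
    (forall_rank_eq_iff P μ fun i c => (r i c).eval μ).1 hr.1.2
  have hsnoc (j : Fin s) (x : κ → ℂ[X]) :
      (∀ (p : ℕ) (N : Matrix κ (Fin p) ℂ[X]), IsMinimalBasis P N →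
        (Matrix.of fun (i : κ) (c : Sum (Fin p) (Fin ((j : ℕ) + 1))) =>
          Sum.elim (fun a => (N i a).eval μ)
            (fun b => if h : (b : ℕ) < (j : ℕ) then (r ⟨(b : ℕ), h.trans j.isLt⟩ i).eval μ
              else (x i).eval μ) c).rank = p + (j : ℕ) + 1) ↔
      (valueSpace P μ 0).mkQ (fun c => (x c).eval μ) ∉
        Submodule.span ℂ (Set.range fun i : Fin j =>
          (valueSpace P μ 0).mkQ fun c => (r (Fin.castLE j.isLt.le i) c).eval μ) := by
    have hrank := forall_rank_eq_iff P μ fun (b : Fin ((j : ℕ) + 1)) i =>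
      if h : (b : ℕ) < (j : ℕ) then (r ⟨(b : ℕ), h.trans j.isLt⟩ i).eval μ
        else (x i).eval μ
    simp only [← Nat.add_assoc] at hrank
    refine Iff.trans (forall₃_congr fun p N _ => iff_of_eq
      (congrArg (fun A : Matrix κ (Fin p ⊕ Fin ((j : ℕ) + 1)) ℂ => A.rank = p + j + 1) ?_))
      (hrank.trans ?_)
    · ext i c
      cases c <;> rfl
    have heq : ((valueSpace P μ 0).mkQ ∘ fun (b : Fin ((j : ℕ) + 1)) i =>
        if h : (b : ℕ) < (j : ℕ) then (r ⟨(b : ℕ), h.trans j.isLt⟩ i).eval μ else (x i).eval μ)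
        = Fin.snoc (α := fun _ => (κ → ℂ) ⧸ valueSpace P μ 0)
          (fun i : Fin j => (valueSpace P μ 0).mkQ fun c => (r (Fin.castLE j.isLt.le i) c).eval μ)
          ((valueSpace P μ 0).mkQ fun c => (x c).eval μ) := by
      funext b
      refine Fin.lastCases ?_ (fun b => ?_) b
      · simp
      · simp [Fin.castLE]
    rw [heq, linearIndependent_finSnoc]
    exact and_iff_right (hli.comp _ (Fin.castLE_injective _))
  constructor
  · rintro ⟨-, -, -, hmax⟩ j l hjl z hz
    by_contra hspan
    obtain ⟨k', x, hlk, hx, rfl⟩ := exists_isRootPoly_of_mem hz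
      fun h0 => hspan (h0 ▸ Submodule.zero_mem _)
    exact hmax j k' (hjl.trans_lt hlk) x hx ((hsnoc j x).2 hspan)
  · refine fun h => ⟨hr, hk, hpos, fun j k' hjk x hx hrank => (hsnoc j x).1 hrank ?_⟩
    exact h j (k' - 1) (by omega) (hx.mkQ_mem (by omega))

end

/-- Dopico–Noferini, Theorem 4.1.3. Let the nonzero partial multiplicities of
`P` at `λ₀` be `0 < σ_1 ≤ … ≤ σ_s` and let `r_1, …, r_s` be a complete, ordered set of root
polynomials at `λ₀` for `P`, of orders `k_1 ≥ … ≥ k_s > 0`. Then: the set is maximal iff the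
multiset of its orders equals the multiset of nonzero partial multiplicities, iff the sum of
the orders equals the sum of the partial multiplicities. -/
theorem maximal_set_iff_orders_are_partial_multiplicities
    {m n : ℕ} (P : Matrix (Fin m) (Fin n) (Polynomial ℂ)) (lam0 : ℂ)
    {r : ℕ} (σ : Fin r → ℕ) (hσ : HasPartialMultiplicities P lam0 σ)
    {s : ℕ} (hs : s = (Finset.univ.filter fun a : Fin r => 0 < σ a).card)
    (k : Fin s → ℕ) (rp : Fin s → Fin n → Polynomial ℂ)
    (hcomplete : IsCompleteFamily P lam0 k rp)
    (hordered : Antitone k) (hpos : ∀ i, 0 < k i) :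
    (IsMaximalFamily P lam0 k rp ↔
      Multiset.map k Finset.univ.val
        = Multiset.map σ ((Finset.univ.filter fun a : Fin r => 0 < σ a).val)) ∧
    (IsMaximalFamily P lam0 k rp ↔ (∑ i, k i) = ∑ a, σ a) := by
  have hfin := finrank_map_mkQ_valueSpace hσ
  have hli : LinearIndependent ℂ fun i =>
      (valueSpace P lam0 0).mkQ fun c => (rp i c).eval lam0 :=
    (forall_rank_eq_iff P lam0 fun i c => (rp i c).eval lam0).1 hcomplete.1.2
  have hmem (i : Fin s) (l : ℕ) (hl : l < k i) := (hcomplete.1.1 i).mkQ_mem hl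
  have hUs (l : ℕ) : Module.finrank ℂ
      ((valueSpace P lam0 ((X - C lam0) ^ (l + 1))).map (valueSpace P lam0 0).mkQ) ≤ s := by
    rw [hfin, hs]
    exact Finset.card_le_card fun a => by
      simpa using fun h => (Nat.zero_le l).trans_lt h
  have hle (l : ℕ) : (Finset.univ.filter fun i => l < k i).card
      ≤ (Finset.univ.filter fun a => l < σ a).card := by
    rw [← hfin, ← Fintype.card_subtype,
      ← finrank_span_eq_card (hli.comp _ (Subtype.val_injective (p := fun i => l < k i)))]
    refine Submodule.finrank_mono (Submodule.span_le.2 ?_)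
    rintro _ ⟨i, rfl⟩
    exact hmem _ _ i.2
  have hcount := forall_le_span_iff_forall_card_eq_finrank hUs hordered hli hmem
  simp only [hfin] at hcount
  have hmain := (isMaximalFamily_iff hcomplete hordered hpos).trans hcount
  exact ⟨hmain.trans (forall_card_lt_eq_iff_multiset_map_eq (g := σ) hpos),
    hmain.trans (forall_card_lt_eq_iff_sum_eq hle)⟩

end
end

section
/- Let L_0+λL_1 be an m×n complex matrix pencil. For k≥1 let T̂_k∈ℂ^{m(k+1)×nk} be the block bidiagonal Toeplitz matrix whose (i,j) block (1≤i≤k+1, 1≤j≤k, blocks of size m×n) equals L_1 if i=j, L_0 if i=j+1, and 0 otherwise, and let μ_k = nk − rank(T̂_k) be its right nullity; set μ_0=μ_{−1}=0. Then for every integer j≥0, the number of right minimal indices of the pencil L_0+λL_1 equal to j is μ_{j−1}−2μ_j+μ_{j+1}. -/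
open Polynomial Matrix

noncomputable section

theorem toRat_mulVec {ι κ : Type*} [Fintype κ] (P : Matrix ι κ ℂ[X]) (v : κ → ℂ[X]) :
    toRat P *ᵥ (fun i => algebraMap ℂ[X] (RatFunc ℂ) (v i)) =
      fun i => algebraMap ℂ[X] (RatFunc ℂ) ((P *ᵥ v) i) := by
  funext i
  exact (RingHom.map_mulVec (algebraMap ℂ[X] (RatFunc ℂ)) P v i).symm

theorem mem_rightNullspace_iff {ι κ : Type*} [Fintype κ] (P : Matrix ι κ ℂ[X]) (v : κ → ℂ[X]) :
    (fun i => algebraMap ℂ[X] (RatFunc ℂ) (v i)) ∈ rightNullspace P ↔ P *ᵥ v = 0 := by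
  rw [rightNullspace, LinearMap.mem_ker, mulVecLin_apply, toRat_mulVec, funext_iff, funext_iff]
  simp

theorem sum_smul_toRat {κ : Type*} {p : ℕ} (N : Matrix κ (Fin p) ℂ[X]) (c : Fin p → RatFunc ℂ) :
    ∑ j, c j • (fun i => toRat N i j) = toRat N *ᵥ c := by
  funext i
  simp [mulVec, dotProduct, Finset.sum_apply, mul_comm]

theorem natDegree_le_colDegree {κ : Type*} [Fintype κ] (v : κ → ℂ[X]) (i : κ) :
    (v i).natDegree ≤ colDegree v :=
  Finset.le_sup (f := fun i => (v i).natDegree) (Finset.mem_univ i)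

theorem coeff_eq_zero_of_colDegree_lt {κ : Type*} [Fintype κ] {v : κ → ℂ[X]} {d : ℕ}
    (h : colDegree v < d) (i : κ) : (v i).coeff d = 0 :=
  coeff_eq_zero_of_natDegree_lt ((natDegree_le_colDegree v i).trans_lt h)

/-- There is a nonzero entry whose column has maximal degree. -/
theorem exists_max_colDegree {κ : Type*} [Fintype κ] {p : ℕ} (N : Matrix κ (Fin p) ℂ[X])
    {β : Fin p → ℂ} (hβ : β ≠ 0) :
    ∃ c, β c ≠ 0 ∧ ∀ j, β j ≠ 0 → colDegree (fun i => N i j) ≤ colDegree (fun i => N i c) := by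
  classical
  obtain ⟨c₀, hc₀⟩ := Function.ne_iff.1 hβ
  obtain ⟨c, hc, hmax⟩ := Finset.exists_max_image (Finset.univ.filter fun j => β j ≠ 0)
    (fun j => colDegree fun i => N i j) ⟨c₀, by simpa using hc₀⟩
  exact ⟨c, by simpa using hc, fun j hj => hmax j (by simpa using hj)⟩

namespace IsMinimalBasis

variable {ι κ : Type*} [Fintype ι] [Fintype κ] {P : Matrix ι κ ℂ[X]} {p : ℕ}
  {N : Matrix κ (Fin p) ℂ[X]}

theorem eq_zero_of_mulVec_eq_zero (hN : IsMinimalBasis P N) {c : Fin p → ℂ[X]}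
    (hc : N *ᵥ c = 0) : c = 0 := by
  have h := Fintype.linearIndependent_iff.1 hN.1 (fun j => algebraMap ℂ[X] (RatFunc ℂ) (c j)) (by
    rw [sum_smul_toRat, toRat_mulVec, hc]
    funext i
    simp)
  funext j
  simpa using h j

/-- Each column of a minimal basis has minimal degree among the polynomial vectors by which it can
be exchanged. -/
theorem colDegree_le_of_smul_eq (hN : IsMinimalBasis P N) {q : ℂ[X]} (hq : q ≠ 0)
    {w : κ → ℂ[X]} {b : Fin p → ℂ[X]} (h : q • w = N *ᵥ b) {c : Fin p} (hb : b c ≠ 0) :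
    colDegree (fun i => N i c) ≤ colDegree w := by
  classical
  have hcol : (fun j : Fin p => fun i : κ => toRat (N.updateCol c w) i j) =
      Function.update (fun j : Fin p => fun i : κ => toRat N i j) c
        (fun i => algebraMap ℂ[X] (RatFunc ℂ) (w i)) := by
    funext j i
    by_cases hj : j = c
    · subst hj
      simp [toRat]
    · simp [toRat, hj]
  have hrat : algebraMap ℂ[X] (RatFunc ℂ) q • (fun i => algebraMap ℂ[X] (RatFunc ℂ) (w i)) =
      toRat N *ᵥ fun j => algebraMap ℂ[X] (RatFunc ℂ) (b j) := by
    rw [toRat_mulVec, ← h]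
    funext i
    simp
  have hq' : algebraMap ℂ[X] (RatFunc ℂ) q ≠ 0 := by simpa using hq
  have hb' : algebraMap ℂ[X] (RatFunc ℂ) (b c) ≠ 0 := by simpa using hb
  have hind : LinearIndependent (RatFunc ℂ)
      (fun j : Fin p => fun i : κ => toRat (N.updateCol c w) i j) := by
    rw [hcol]
    refine hN.1.update c _ ⟨_, mem_nonZeroDivisors_of_ne_zero hq',
      Finsupp.equivFunOnFinite.symm (fun j => algebraMap ℂ[X] (RatFunc ℂ) (b j)),
      mem_nonZeroDivisors_of_ne_zero hb', ?_⟩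
    rw [hrat, Finsupp.linearCombination_apply, Finsupp.sum_fintype _ _ (by simp)]
    exact (sum_smul_toRat N _).symm
  have hmem : (fun i => algebraMap ℂ[X] (RatFunc ℂ) (w i)) ∈
      Submodule.span (RatFunc ℂ) (Set.range fun j : Fin p => fun i : κ => toRat N i j) := by
    rw [← Submodule.smul_mem_iff _ hq', hrat, ← sum_smul_toRat]
    exact Submodule.sum_mem _ fun j _ =>
      Submodule.smul_mem _ _ (Submodule.subset_span ⟨j, rfl⟩)
  have hspan : Submodule.span (RatFunc ℂ)
      (Set.range fun j : Fin p => fun i : κ => toRat (N.updateCol c w) i j) =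
        rightNullspace P := by
    rw [← hN.2.1]
    refine Submodule.eq_of_le_of_finrank_eq (Submodule.span_le.2 ?_) ?_
    · rw [hcol]
      rintro _ ⟨j, rfl⟩
      by_cases hj : j = c
      · subst hj
        simpa using hmem
      · rw [Function.update_of_ne hj]
        exact Submodule.subset_span ⟨j, rfl⟩
    · rw [finrank_span_eq_card hind, finrank_span_eq_card hN.1]
  have hmin := hN.2.2 _ hind hspan
  rw [← Finset.add_sum_erase _ _ (Finset.mem_univ c),
    ← Finset.add_sum_erase _ (fun j => colDegree fun i => N.updateCol c w i j)
      (Finset.mem_univ c)] at hmin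
  have hrest : ∑ j ∈ Finset.univ.erase c, (colDegree fun i => N.updateCol c w i j) =
      ∑ j ∈ Finset.univ.erase c, colDegree fun i => N i j := by
    refine Finset.sum_congr rfl fun j hj => ?_
    simp [Finset.ne_of_mem_erase hj]
  simpa [hrest] using hmin

/-- The values at any point of the columns of a minimal basis are linearly independent. -/
theorem eq_zero_of_X_sub_C_smul (hN : IsMinimalBasis P N) {α : ℂ} {w : κ → ℂ[X]}
    {β : Fin p → ℂ} (h : (X - C α) • w = N *ᵥ fun j => C (β j)) : β = 0 := by
  by_contra hβ
  obtain ⟨c, hc, hmax⟩ := exists_max_colDegree N hβ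
  have hle := hN.colDegree_le_of_smul_eq (X_sub_C_ne_zero α) h
    (c := c) (by simpa using hc)
  have hw : w ≠ 0 := by
    rintro rfl
    have := hN.eq_zero_of_mulVec_eq_zero (c := fun j => C (β j)) (by rw [← h, smul_zero])
    exact hc (by simpa using congrFun this c)
  have hdeg (i : κ) (hi : w i ≠ 0) :
      (w i).natDegree + 1 ≤ colDegree (fun i => N i c) := by
    have h1 : ((X - C α) * w i).natDegree = (w i).natDegree + 1 := by
      rw [natDegree_mul (X_sub_C_ne_zero α) hi, natDegree_X_sub_C, add_comm]
    rw [← h1, show (X - C α) * w i = (N *ᵥ fun j => C (β j)) i by rw [← h]; rfl]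
    change (∑ j, N i j * C (β j)).natDegree ≤ _
    refine natDegree_sum_le_of_forall_le _ _ fun j _ => ?_
    by_cases hj : β j = 0
    · simp [hj]
    · exact (natDegree_mul_C_le _ _).trans
        ((natDegree_le_colDegree (fun i => N i j) i).trans (hmax j hj))
  obtain ⟨i₀, hi₀⟩ := Function.ne_iff.1 hw
  have hpos := hdeg i₀ hi₀
  have : colDegree w < colDegree (fun i => N i c) := by
    refine (Finset.sup_lt_iff (by rw [bot_eq_zero]; omega)).2 fun i _ => ?_
    by_cases hi : w i = 0
    · rw [hi, natDegree_zero]; omega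
    · exact hdeg i hi
  omega

/-- The leading coefficient vectors of the columns of a minimal basis are linearly independent. -/
theorem eq_zero_of_sum_leadingCoeff (hN : IsMinimalBasis P N) {β : Fin p → ℂ}
    (h : ∀ i, ∑ j, (N i j).coeff (colDegree fun i => N i j) * β j = 0) : β = 0 := by
  by_contra hβ
  obtain ⟨c, hc, hmax⟩ := exists_max_colDegree N hβ
  set D := colDegree (fun i => N i c)
  set b : Fin p → ℂ[X] := fun j => C (β j) * X ^ (D - colDegree fun i => N i j) with hb
  have hbc : b c ≠ 0 := by simp [hb, hc]
  have hle := hN.colDegree_le_of_smul_eq one_ne_zero (one_smul _ (N *ᵥ b)) hbc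
  have hnat (i : κ) : ((N *ᵥ b) i).natDegree ≤ D := by
    change (∑ j, N i j * b j).natDegree ≤ _
    refine natDegree_sum_le_of_forall_le _ _ fun j _ => ?_
    by_cases hj : β j = 0
    · simp [hb, hj]
    · have h1 := natDegree_le_colDegree (fun i => N i j) i
      have h2 := hmax j hj
      have h3 : (b j).natDegree ≤ D - colDegree fun i => N i j :=
        natDegree_C_mul_X_pow_le _ _
      exact natDegree_mul_le.trans (by omega)
  have hcoeff (i : κ) : ((N *ᵥ b) i).coeff D = 0 := by
    rw [← h i, mulVec, dotProduct, finsetSum_coeff]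
    refine Finset.sum_congr rfl fun j _ => ?_
    by_cases hj : β j = 0
    · simp [hb, hj]
    · have h2 := hmax j hj
      rw [hb, ← mul_assoc, coeff_mul_X_pow', if_pos (Nat.sub_le _ _), coeff_mul_C,
        Nat.sub_sub_self h2]
  have hlt (i : κ) (hi : (N *ᵥ b) i ≠ 0) : ((N *ᵥ b) i).natDegree < D :=
    (hnat i).lt_of_ne fun he => hi (leadingCoeff_eq_zero.1 (by
      rw [leadingCoeff, he, hcoeff]))
  have hne : N *ᵥ b ≠ 0 := fun h0 =>
    hbc (by rw [hN.eq_zero_of_mulVec_eq_zero h0]; rfl)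
  obtain ⟨i₀, hi₀⟩ := Function.ne_iff.1 hne
  have hpos := hlt i₀ hi₀
  have : colDegree (N *ᵥ b) < D := by
    refine (Finset.sup_lt_iff (by rw [bot_eq_zero]; omega)).2 fun i _ => ?_
    by_cases hi : (N *ᵥ b) i = 0
    · rw [hi, natDegree_zero]; omega
    · exact hlt i hi
  omega

theorem exists_mulVec_eq_of_smul_eq (hN : IsMinimalBasis P N) (d : ℕ) {q : ℂ[X]}
    (hd : q.natDegree = d) (hq : q ≠ 0) {v : κ → ℂ[X]} {b : Fin p → ℂ[X]}
    (h : q • v = N *ᵥ b) : ∃ c, v = N *ᵥ c := by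
  induction d generalizing q b with
  | zero =>
    obtain ⟨a, rfl⟩ := natDegree_eq_zero.1 hd
    have ha : a ≠ 0 := by simpa using hq
    refine ⟨C a⁻¹ • b, ?_⟩
    rw [mulVec_smul, ← h, smul_smul, ← C_mul, inv_mul_cancel₀ ha, C_1, one_smul]
  | succ d ih =>
    obtain ⟨α, hα⟩ := Complex.exists_root (f := q)
      (natDegree_pos_iff_degree_pos.1 (by omega))
    obtain ⟨q', rfl⟩ := dvd_iff_isRoot.2 hα
    have hq' : q' ≠ 0 := right_ne_zero_of_mul hq
    rw [natDegree_mul (X_sub_C_ne_zero α) hq', natDegree_X_sub_C] at hd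
    set b' : Fin p → ℂ[X] := fun j => b j /ₘ (X - C α)
    have hdiv : b = (X - C α) • b' + fun j => C ((b j).eval α) := by
      funext j
      have := modByMonic_add_div (b j) (X - C α)
      rw [modByMonic_X_sub_C_eq_C_eval] at this
      exact this.symm.trans (add_comm _ _)
    have hzero : (fun j => (b j).eval α) = 0 := by
      refine hN.eq_zero_of_X_sub_C_smul (α := α) (w := q' • v - N *ᵥ b') ?_
      rw [smul_sub, smul_smul, h, ← mulVec_smul, ← mulVec_sub]
      congr 1
      exact sub_eq_of_eq_add' hdiv
    refine ih (b := b') (by omega) hq' ?_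
    have hb : b = (X - C α) • b' := by
      rw [hdiv]
      funext j
      have hj : (b j).eval α = 0 := congrFun hzero j
      simp [hj]
    rw [hb, mulVec_smul, ← smul_smul] at h
    exact smul_right_injective _ (X_sub_C_ne_zero α) h

/-- Every polynomial vector in the right nullspace is a polynomial combination of the columns of a
minimal basis. -/
theorem exists_mulVec_eq (hN : IsMinimalBasis P N) {v : κ → ℂ[X]} (hv : P *ᵥ v = 0) :
    ∃ c, v = N *ᵥ c := by
  have hmem := (mem_rightNullspace_iff P v).2 hv
  rw [← hN.2.1, Submodule.mem_span_range_iff_exists_fun] at hmem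
  obtain ⟨a, ha⟩ := hmem
  obtain ⟨q, hq⟩ := IsLocalization.exist_integer_multiples_of_finite (nonZeroDivisors ℂ[X]) a
  choose b hb using hq
  refine hN.exists_mulVec_eq_of_smul_eq _ rfl (nonZeroDivisors.ne_zero q.2) (b := b) ?_
  have key : (fun i => algebraMap ℂ[X] (RatFunc ℂ) (((q : ℂ[X]) • v) i)) =
      fun i => algebraMap ℂ[X] (RatFunc ℂ) ((N *ᵥ b) i) := by
    rw [← toRat_mulVec, funext hb]
    change _ = toRat N *ᵥ ((q : ℂ[X]) • a)
    rw [mulVec_smul, ← sum_smul_toRat, ha]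
    funext i
    simp [Algebra.smul_def]
  funext i
  exact RatFunc.algebraMap_injective ℂ (congrFun key i)

/-- The predictable degree property of minimal bases. -/
theorem coeff_eq_zero_of_mulVec (hN : IsMinimalBasis P N) {c : Fin p → ℂ[X]} {k : ℕ}
    (hc : ∀ i e, k ≤ e → ((N *ᵥ c) i).coeff e = 0) (j : Fin p) (e : ℕ)
    (he : k ≤ e + colDegree (fun i => N i j)) : (c j).coeff e = 0 := by
  suffices H : ∀ D, k ≤ D → ∀ j e, D ≤ e + colDegree (fun i => N i j) → (c j).coeff e = 0 from
    H k le_rfl j e he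
  set B := ∑ j, ((c j).natDegree + colDegree (fun i => N i j))
  have hbound (j : Fin p) : (c j).natDegree + colDegree (fun i => N i j) ≤ B :=
    Finset.single_le_sum (f := fun j => (c j).natDegree + colDegree (fun i => N i j))
      (fun _ _ => Nat.zero_le _) (Finset.mem_univ j)
  intro D hD
  by_cases hDB : B < D
  · intro j e hje
    have := hbound j
    exact coeff_eq_zero_of_natDegree_lt (by omega)
  refine Nat.decreasingInduction' (n := B + 1) (m := D)
    (P := fun D => ∀ j e, D ≤ e + colDegree (fun i => N i j) → (c j).coeff e = 0)
    ?_ (by omega) ?_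
  · intro D' _ hD' ih j e hje
    rcases hje.lt_or_eq with hlt | heq
    · exact ih j e hlt
    have hz := hN.eq_zero_of_sum_leadingCoeff
      (β := fun j => if colDegree (fun i => N i j) ≤ D' then
        (c j).coeff (D' - colDegree fun i => N i j) else 0) (by
      intro i
      refine Eq.trans ?_ (hc i D' (hD.trans hD'))
      rw [mulVec, dotProduct, finsetSum_coeff]
      refine Finset.sum_congr rfl fun j _ => ?_
      rw [coeff_mul]
      split_ifs with hjD
      · rw [Finset.sum_eq_single (colDegree (fun i => N i j),
          D' - colDegree fun i => N i j)]
        · rintro ⟨s, t⟩ hst hne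
          rw [Finset.HasAntidiagonal.mem_antidiagonal] at hst
          dsimp only at hst ⊢
          rcases lt_trichotomy s (colDegree fun i => N i j) with hs | hs | hs
          · rw [ih j t (by omega), mul_zero]
          · exact absurd (Prod.ext hs (by omega)) hne
          · rw [coeff_eq_zero_of_colDegree_lt hs i, zero_mul]
        · intro hn
          exact absurd (Finset.HasAntidiagonal.mem_antidiagonal.2 (by omega)) hn
      · rw [mul_zero, eq_comm]
        refine Finset.sum_eq_zero ?_
        rintro ⟨s, t⟩ hst
        rw [Finset.HasAntidiagonal.mem_antidiagonal] at hst
        dsimp only at hst ⊢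
        rw [ih j t (by omega), mul_zero])
    have := congrFun hz j
    simp only [Pi.zero_apply] at this
    rwa [if_pos (by omega), show D' - colDegree (fun i => N i j) = e by omega] at this
  · intro j e hje
    have := hbound j
    exact coeff_eq_zero_of_natDegree_lt (by omega)

end IsMinimalBasis

/-- The block bidiagonal Toeplitz matrix with `L₁` on the block diagonal and `L₀` on the block
subdiagonal. -/
def toeplitzMat {m n : ℕ} (L0 L1 : Matrix (Fin m) (Fin n) ℂ) (k : ℕ) :
    Matrix (Fin (k + 1) × Fin m) (Fin k × Fin n) ℂ :=
  Matrix.of fun p q =>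
    if (p.1 : ℕ) = (q.1 : ℕ) then L1 p.2 q.2
    else if (p.1 : ℕ) = (q.1 : ℕ) + 1 then L0 p.2 q.2 else 0

section Toeplitz

variable {m n k : ℕ} (L0 L1 : Matrix (Fin m) (Fin n) ℂ)

theorem coeff_pencilMat_mul_zero (r : Fin m) (x : Fin n) (f : ℂ[X]) :
    (pencilMat L0 L1 r x * f).coeff 0 = L0 r x * f.coeff 0 := by
  simp [pencilMat, add_mul, mul_assoc]

theorem coeff_pencilMat_mul_succ (r : Fin m) (x : Fin n) (f : ℂ[X]) (e : ℕ) :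
    (pencilMat L0 L1 r x * f).coeff (e + 1) =
      L0 r x * f.coeff (e + 1) + L1 r x * f.coeff e := by
  simp [pencilMat, add_mul, mul_assoc, coeff_X_mul]

/-- The Toeplitz matrix acts on coefficient vectors, listed from the top degree down, as
multiplication by the pencil. -/
theorem toeplitzMat_mulVec_coeff {v : Fin n → ℂ[X]}
    (hv : ∀ x e, k ≤ e → (v x).coeff e = 0) (s : Fin (k + 1)) (r : Fin m) :
    (toeplitzMat L0 L1 k *ᵥ fun q => (v q.2).coeff (k - 1 - q.1)) (s, r) =
      ((pencilMat L0 L1 *ᵥ v) r).coeff (k - s) := by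
  obtain ⟨s, hs⟩ := s
  simp only [mulVec, dotProduct, finsetSum_coeff, Fintype.sum_prod_type_right]
  refine Finset.sum_congr rfl fun x _ => ?_
  have hterm (a : ℕ) :
      (if s = a then L1 r x else if s = a + 1 then L0 r x else 0) * (v x).coeff (k - 1 - a) =
        (if s = a then L1 r x * (v x).coeff (k - 1 - s) else 0) +
          if s = a + 1 then L0 r x * (v x).coeff (k - s) else 0 := by
    by_cases h1 : s = a
    · simp [h1]
    · by_cases h2 : s = a + 1
      · simp [h2, Nat.sub_sub, add_comm 1]
      · simp [h1, h2]
  refine (Fin.sum_univ_eq_sum_range (fun a => (if s = a then L1 r x else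
    if s = a + 1 then L0 r x else 0) * (v x).coeff (k - 1 - a)) k).trans ?_
  simp only [hterm, Finset.sum_add_distrib, Finset.sum_ite_eq, Finset.mem_range]
  have hsub : ∑ a ∈ Finset.range k, (if s = a + 1 then L0 r x * (v x).coeff (k - s) else 0) =
      L0 r x * (v x).coeff (k - s) := by
    cases s with
    | zero => simp [hv x k le_rfl]
    | succ s => simp; omega
  rw [hsub]
  split_ifs with hsk
  · obtain ⟨e, he⟩ : ∃ e, k - s = e + 1 := ⟨k - s - 1, by omega⟩
    rw [he, coeff_pencilMat_mul_succ, show k - 1 - s = e by omega, add_comm]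
  · rw [show k - s = 0 by omega, coeff_pencilMat_mul_zero, zero_add]

theorem pencilMat_mulVec_eq_zero_iff {v : Fin n → ℂ[X]}
    (hv : ∀ x e, k ≤ e → (v x).coeff e = 0) :
    pencilMat L0 L1 *ᵥ v = 0 ↔
      (toeplitzMat L0 L1 k *ᵥ fun q => (v q.2).coeff (k - 1 - q.1)) = 0 := by
  constructor
  · intro h
    funext ⟨s, r⟩
    rw [toeplitzMat_mulVec_coeff L0 L1 hv, h]
    simp
  · intro h
    funext r
    ext e
    rcases le_or_gt e k with he | he
    · have := congrFun h (⟨k - e, by omega⟩, r)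
      rw [toeplitzMat_mulVec_coeff L0 L1 hv] at this
      simpa [Nat.sub_sub_self he] using this
    · obtain ⟨e, rfl⟩ : ∃ e', e = e' + 1 := ⟨e - 1, by omega⟩
      rw [mulVec, dotProduct, finsetSum_coeff]
      refine Finset.sum_eq_zero fun x _ => ?_
      rw [coeff_pencilMat_mul_succ, hv x _ he.le, hv x _ (by omega)]
      simp

variable {p : ℕ}

/-- The coefficient vectors, listed from the top degree down, of the combinations of the columns of
`N` by polynomials of bounded degree. -/
def coeffCombination (N : Matrix (Fin n) (Fin p) ℂ[X]) (k : ℕ) :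
    ((j : Fin p) → degreeLT ℂ (k - colDegree fun i => N i j)) →ₗ[ℂ] (Fin k × Fin n → ℂ) where
  toFun c q := ((N *ᵥ fun j => (c j : ℂ[X])) q.2).coeff (k - 1 - q.1)
  map_add' c c' := by
    funext q
    simp [mulVec, dotProduct, mul_add, Finset.sum_add_distrib]
  map_smul' a c := by
    funext q
    simp [mulVec, dotProduct, Finset.mul_sum]

theorem coeff_mulVec_degreeLT (N : Matrix (Fin n) (Fin p) ℂ[X])
    (c : (j : Fin p) → degreeLT ℂ (k - colDegree fun i => N i j)) (i : Fin n) (e : ℕ)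
    (he : k ≤ e) : ((N *ᵥ fun j => (c j : ℂ[X])) i).coeff e = 0 := by
  rw [mulVec, dotProduct, finsetSum_coeff]
  refine Finset.sum_eq_zero fun j _ => ?_
  by_cases hc : (c j : ℂ[X]) = 0
  · rw [hc, mul_zero, coeff_zero]
  · have h1 := (natDegree_lt_iff_degree_lt hc).2 (mem_degreeLT.1 (c j).2)
    have h2 := natDegree_le_colDegree (fun i => N i j) i
    have h3 := natDegree_mul_le (p := N i j) (q := c j)
    exact coeff_eq_zero_of_natDegree_lt (by omega)

theorem eq_zero_of_coeff_top_down {v : Fin n → ℂ[X]} (hv : ∀ x e, k ≤ e → (v x).coeff e = 0)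
    (h : (fun q : Fin k × Fin n => (v q.2).coeff (k - 1 - q.1)) = 0) : v = 0 := by
  funext x
  ext e
  rcases le_or_gt k e with he | he
  · simpa using hv x e he
  · simpa [show k - 1 - (k - 1 - e) = e by omega] using
      congrFun h (⟨k - 1 - e, by omega⟩, x)

variable {L0 L1} {N : Matrix (Fin n) (Fin p) ℂ[X]}

theorem IsMinimalBasis.coeffCombination_injective (hN : IsMinimalBasis (pencilMat L0 L1) N) :
    Function.Injective (coeffCombination N k) := by
  refine (injective_iff_map_eq_zero _).2 fun c hc => ?_
  have h := hN.eq_zero_of_mulVec_eq_zero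
    (eq_zero_of_coeff_top_down (coeff_mulVec_degreeLT N c) hc)
  funext j
  exact Subtype.ext (congrFun h j)

theorem IsMinimalBasis.range_coeffCombination (hN : IsMinimalBasis (pencilMat L0 L1) N) :
    LinearMap.range (coeffCombination N k) = LinearMap.ker (toeplitzMat L0 L1 k).mulVecLin := by
  ext y
  rw [LinearMap.mem_range, LinearMap.mem_ker, mulVecLin_apply]
  constructor
  · rintro ⟨c, rfl⟩
    refine (pencilMat_mulVec_eq_zero_iff L0 L1 (coeff_mulVec_degreeLT N c)).1 ?_
    have hker (b : Fin p → ℂ[X]) : pencilMat L0 L1 *ᵥ (N *ᵥ b) = 0 := by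
      rw [← mem_rightNullspace_iff, ← toRat_mulVec,
        ← sum_smul_toRat, ← hN.2.1]
      exact Submodule.sum_mem _ fun j _ =>
        Submodule.smul_mem _ _ (Submodule.subset_span ⟨j, rfl⟩)
    exact hker _
  · intro hy
    set v : Fin n → ℂ[X] := fun x => ∑ a : Fin k, monomial (k - 1 - a) (y (a, x)) with hv
    have hdeg (x : Fin n) (e : ℕ) (he : k ≤ e) : (v x).coeff e = 0 := by
      rw [hv, finsetSum_coeff]
      exact Finset.sum_eq_zero fun a _ => coeff_monomial_of_ne _ (by omega)
    have hcoeff : (fun q : Fin k × Fin n => (v q.2).coeff (k - 1 - q.1)) = y := by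
      funext ⟨a, x⟩
      rw [hv, finsetSum_coeff, Finset.sum_eq_single a]
      · exact coeff_monomial_same _ _
      · exact fun a' _ ha' => coeff_monomial_of_ne _ (by
          have := Fin.val_ne_of_ne ha'
          dsimp only
          omega)
      · simp
    obtain ⟨c, hc⟩ := hN.exists_mulVec_eq
      ((pencilMat_mulVec_eq_zero_iff L0 L1 hdeg).2 (by rw [hcoeff, hy]))
    have hpred := hN.coeff_eq_zero_of_mulVec (c := c) (k := k) (by rwa [← hc])
    refine ⟨fun j => ⟨c j, mem_degreeLT.2 ((degree_lt_iff_coeff_zero _ _).2 fun e he =>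
      hpred j e (by omega))⟩, ?_⟩
    rw [← hcoeff, hc]
    rfl

theorem IsMinimalBasis.toeplitzMat_rank_add (hN : IsMinimalBasis (pencilMat L0 L1) N) (k : ℕ) :
    (toeplitzMat L0 L1 k).rank + ∑ j, (k - colDegree fun i => N i j) = n * k := by
  have hfin (d : ℕ) : Module.Finite ℂ (degreeLT ℂ d) :=
    Module.Finite.equiv (degreeLTEquiv ℂ d).symm
  have hdim : Module.finrank ℂ (LinearMap.ker (toeplitzMat L0 L1 k).mulVecLin) =
      ∑ j, (k - colDegree fun i => N i j) := by
    rw [← hN.range_coeffCombination, LinearMap.finrank_range_of_inj hN.coeffCombination_injective,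
      Module.finrank_pi_fintype]
    exact Finset.sum_congr rfl fun j _ => by
      rw [(degreeLTEquiv ℂ _).finrank_eq, Module.finrank_fin_fun]
  rw [← hdim, Matrix.rank, LinearMap.finrank_range_add_finrank_ker]
  simp [mul_comm]

end Toeplitz

/-- Karcanias–Kalogeropoulos. For `k ≥ 1` let `T̂_k` be the block bidiagonal
Toeplitz matrix with `L₁` on the block diagonal and `L₀` on the block subdiagonal, and let
`μ_k = nk − rank T̂_k` be its right nullity (`μ₀ = μ₋₁ = 0`).  Then for every `j ≥ 0` the
number of right minimal indices of `L₀ + λL₁` equal to `j` is `μ_{j−1} − 2μ_j + μ_{j+1}`. -/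
theorem count_right_minimal_indices_eq_toeplitz_nullities
    {m n : ℕ} (L0 L1 : Matrix (Fin m) (Fin n) ℂ) (μ : ℕ → ℤ) (hμ0 : μ 0 = 0)
    (hμ : ∀ k : ℕ, 1 ≤ k →
      μ k = (n * k : ℕ) -
        (Matrix.rank (Matrix.of fun (p : Fin (k+1) × Fin m) (q : Fin k × Fin n) =>
          if (p.1 : ℕ) = (q.1 : ℕ) then L1 p.2 q.2
          else if (p.1 : ℕ) = (q.1 : ℕ) + 1 then L0 p.2 q.2 else 0) : ℕ)) :
    ∀ (j : ℕ) (p : ℕ) (N : Matrix (Fin n) (Fin p) (Polynomial ℂ)),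
      IsMinimalBasis (pencilMat L0 L1) N →
      ((Finset.univ.filter fun c : Fin p => colDegree (fun i => N i c) = j).card : ℤ)
        = μ (j - 1) - 2 * μ j + μ (j + 1) := by
  intro j p N hN
  have hμ' (k : ℕ) : μ k = ∑ c, ((k - colDegree fun i => N i c : ℕ) : ℤ) := by
    rcases Nat.eq_zero_or_pos k with rfl | hk
    · simp [hμ0]
    · have h := hN.toeplitzMat_rank_add k
      rw [hμ k hk, ← h, toeplitzMat]
      push_cast
      ring
  rw [hμ', hμ', hμ', Finset.card_filter, Finset.mul_sum, ← Finset.sum_sub_distrib,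
    ← Finset.sum_add_distrib, Nat.cast_sum]
  refine Finset.sum_congr rfl fun c _ => ?_
  split_ifs with h <;> omega

end
end

section
/- Let Ã+λẼ∈ℂ[λ]^{m×n} be a pencil in special staircase form with block sizes s_1,…,s_k (rows) and t_1,…,t_k (columns). Then there exist unit upper triangular matrices S∈ℂ^{m×m} and T∈ℂ^{n×n} such that S^{−1}(Ã+λẼ)T is the block bidiagonal pencil whose (i,i) block equals λE_{i,i} (i=1,…,k), whose (i,i+1) block equals A_{i,i+1} (i=1,…,k−1), and all of whose other blocks are zero; in particular the rank-carrying stairs E_{i,i} and A_{i,i+1} are unaltered. -/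
open Polynomial Matrix

noncomputable section

/-- Strict lexicographic (block, position) order on block-partitioned indices: used to express
that a matrix indexed by such blocks is (entrywise) upper triangular. -/
def blkLT {k : ℕ} {s : Fin k → ℕ} (p q : Σ i : Fin k, Fin (s i)) : Prop :=
  p.1 < q.1 ∨ (p.1 = q.1 ∧ (p.2 : ℕ) < (q.2 : ℕ))

/-- A block-partitioned matrix whose blocks `(i, j)` vanish unless `i + d ≤ j`. -/
def IsBlockUpper {k : ℕ} {s t : Fin k → ℕ} (d : ℤ)
    (M : Matrix (Σ i : Fin k, Fin (s i)) (Σ i : Fin k, Fin (t i)) ℂ) : Prop :=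
  ∀ p q, ((q.1 : ℕ) : ℤ) < ((p.1 : ℕ) : ℤ) + d → M p q = 0

namespace IsBlockUpper

variable {k : ℕ} {s t u : Fin k → ℕ}

theorem mul {d e : ℤ} {M : Matrix (Σ i : Fin k, Fin (s i)) (Σ i : Fin k, Fin (t i)) ℂ}
    {N : Matrix (Σ i : Fin k, Fin (t i)) (Σ i : Fin k, Fin (u i)) ℂ}
    (hM : IsBlockUpper d M) (hN : IsBlockUpper e N) : IsBlockUpper (d + e) (M * N) := by
  intro p q h
  rw [Matrix.mul_apply]
  refine Finset.sum_eq_zero fun r _ => ?_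
  by_cases hr : ((r.1 : ℕ) : ℤ) < ((p.1 : ℕ) : ℤ) + d
  · rw [hM p r hr, zero_mul]
  · rw [hN r q (by omega), mul_zero]

theorem add {d : ℤ} {M N : Matrix (Σ i : Fin k, Fin (s i)) (Σ i : Fin k, Fin (t i)) ℂ}
    (hM : IsBlockUpper d M) (hN : IsBlockUpper d N) : IsBlockUpper d (M + N) := by
  intro p q h
  rw [Matrix.add_apply, hM p q h, hN p q h, add_zero]

theorem sub {d : ℤ} {M N : Matrix (Σ i : Fin k, Fin (s i)) (Σ i : Fin k, Fin (t i)) ℂ}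
    (hM : IsBlockUpper d M) (hN : IsBlockUpper d N) : IsBlockUpper d (M - N) := by
  intro p q h
  rw [Matrix.sub_apply, hM p q h, hN p q h, sub_zero]

theorem mono {d e : ℤ} (h : e ≤ d)
    {M : Matrix (Σ i : Fin k, Fin (s i)) (Σ i : Fin k, Fin (t i)) ℂ}
    (hM : IsBlockUpper d M) : IsBlockUpper e M :=
  fun p q hpq => hM p q (by omega)

/-- Multiplying on the left by a strictly block upper triangular matrix increases the number of
trailing block rows known to vanish. -/
theorem mul_eq_zero_of_rows {M : Matrix (Σ i : Fin k, Fin (s i)) (Σ i : Fin k, Fin (t i)) ℂ}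
    (hM : IsBlockUpper 1 M) {ι : Type*} {N : Matrix (Σ i : Fin k, Fin (t i)) ι ℂ} {m : ℕ}
    (hN : ∀ r, k ≤ (r.1 : ℕ) + m → ∀ q, N r q = 0)
    (p : Σ i : Fin k, Fin (s i)) (hp : k ≤ (p.1 : ℕ) + (m + 1)) (q : ι) : (M * N) p q = 0 := by
  rw [Matrix.mul_apply]
  refine Finset.sum_eq_zero fun r _ => ?_
  by_cases hr : ((r.1 : ℕ) : ℤ) < ((p.1 : ℕ) : ℤ) + 1
  · rw [hM p r hr, zero_mul]
  · rw [hN r (by omega) q, mul_zero]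

/-- One plus a strictly block upper triangular matrix is unit upper triangular. -/
theorem one_add_unitUpper {N : Matrix (Σ i : Fin k, Fin (s i)) (Σ i : Fin k, Fin (s i)) ℂ}
    (hN : IsBlockUpper 1 N) :
    (∀ p q, blkLT q p → (1 + N) p q = 0) ∧ ∀ p, (1 + N) p p = 1 := by
  refine ⟨fun p q h => ?_, fun p => ?_⟩
  · have hne : p ≠ q := by
      rintro rfl
      rcases h with h | ⟨-, h⟩
      · exact lt_irrefl _ h
      · exact lt_irrefl _ h
    have hle : (q.1 : ℕ) ≤ (p.1 : ℕ) := by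
      rcases h with h | ⟨h, -⟩
      · exact le_of_lt h
      · rw [h]
    rw [Matrix.add_apply, Matrix.one_apply_ne hne, hN p q (by omega), add_zero]
  · rw [Matrix.add_apply, Matrix.one_apply_eq, hN p p (by omega), add_zero]

/-- An affine equation `N = C + P N Q - R N` with `P`, `R` strictly block upper triangular
has a solution, which is strictly block upper triangular when the equation preserves that shape. -/
theorem exists_fixedPoint {C P Q R : Matrix (Σ i : Fin k, Fin (t i)) (Σ i : Fin k, Fin (t i)) ℂ}
    (hC : IsBlockUpper 1 C) (hP : IsBlockUpper 1 P) (hQ : IsBlockUpper (-1) Q)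
    (hR : IsBlockUpper 1 R) :
    ∃ N, IsBlockUpper 1 N ∧ N = C + P * N * Q - R * N := by
  let F : Matrix (Σ i : Fin k, Fin (t i)) (Σ i : Fin k, Fin (t i)) ℂ →
      Matrix (Σ i : Fin k, Fin (t i)) (Σ i : Fin k, Fin (t i)) ℂ := fun N => C + P * N * Q - R * N
  have hup : ∀ m : ℕ, IsBlockUpper 1 (F^[m] 0) := by
    intro m
    induction m with
    | zero => intro p q _; rfl
    | succ m ih =>
      rw [Function.iterate_succ_apply']
      exact (hC.add (((hP.mul ih).mul hQ).mono (by norm_num))).sub ((hR.mul ih).mono (by norm_num))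
  have hrow : ∀ m : ℕ, ∀ r : (Σ i : Fin k, Fin (t i)), k ≤ (r.1 : ℕ) + m →
      ∀ q, (F^[m + 1] 0 - F^[m] 0) r q = 0 := by
    intro m
    induction m with
    | zero => intro r h; exact absurd r.1.isLt (by omega)
    | succ m ih =>
      intro r h q
      have key : F^[m + 1 + 1] 0 - F^[m + 1] 0 =
          P * (F^[m + 1] 0 - F^[m] 0) * Q - R * (F^[m + 1] 0 - F^[m] 0) := by
        rw [Function.iterate_succ_apply' F (m + 1), Function.iterate_succ_apply' F m]
        generalize F^[m] 0 = Y
        simp only [F]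
        noncomm_ring
      rw [key, Matrix.sub_apply, hR.mul_eq_zero_of_rows ih r h q, Matrix.mul_apply, sub_zero]
      exact Finset.sum_eq_zero fun x _ => by rw [hP.mul_eq_zero_of_rows ih r h x, zero_mul]
  refine ⟨F^[k] 0, hup k, ?_⟩
  have h0 : F^[k + 1] 0 - F^[k] 0 = 0 := by
    ext r q
    exact hrow k r (by omega) q
  rw [Function.iterate_succ_apply', sub_eq_zero] at h0
  exact h0.symm

end IsBlockUpper

/-- A matrix with an invertible upper triangular block on top of a zero block has a left inverse. -/
theorem exists_left_inverse_of_stair {s t : ℕ} (h : t ≤ s) (M : Matrix (Fin s) (Fin t) ℂ)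
    (htri : ∀ (a : Fin s) (b : Fin t), (b : ℕ) < (a : ℕ) → M a b = 0)
    (hdiag : ∀ (a : Fin s) (b : Fin t), (b : ℕ) = (a : ℕ) → M a b ≠ 0) :
    ∃ L : Matrix (Fin t) (Fin s) ℂ, L * M = 1 := by
  have hdet : IsUnit (M.submatrix (Fin.castLE h) id).det := by
    have hup : (M.submatrix (Fin.castLE h) id).IsUpperTriangular :=
      fun a b hab => htri (Fin.castLE h a) b hab
    rw [Matrix.det_of_isUpperTriangular hup, isUnit_iff_ne_zero]
    exact Finset.prod_ne_zero_iff.mpr fun a _ => hdiag _ _ (by simp)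
  refine ⟨(M.submatrix (Fin.castLE h) id)⁻¹ *
    (1 : Matrix (Fin s) (Fin s) ℂ).submatrix (Fin.castLE h) id, ?_⟩
  have hsub : (1 : Matrix (Fin s) (Fin s) ℂ).submatrix (Fin.castLE h) id * M =
      M.submatrix (Fin.castLE h) id := by
    ext a b
    simp [Matrix.mul_apply, Matrix.one_apply]
  rw [Matrix.mul_assoc, hsub, Matrix.nonsing_inv_mul _ hdet]

/-- A matrix with an invertible upper triangular block to the right of a zero block has a right
inverse. -/
theorem exists_right_inverse_of_stair {s t : ℕ} (h : s ≤ t) (M : Matrix (Fin s) (Fin t) ℂ)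
    (htri : ∀ (a : Fin s) (b : Fin t), (b : ℕ) < t - s + (a : ℕ) → M a b = 0)
    (hdiag : ∀ (a : Fin s) (b : Fin t), (b : ℕ) = t - s + (a : ℕ) → M a b ≠ 0) :
    ∃ R : Matrix (Fin t) (Fin s) ℂ, M * R = 1 := by
  let e : Fin s → Fin t := fun a => ⟨t - s + a, by omega⟩
  have hdet : IsUnit (M.submatrix id e).det := by
    have hup : (M.submatrix id e).IsUpperTriangular :=
      fun a b hab => htri a (e b) (Nat.add_lt_add_left (show (b : ℕ) < a from hab) _)
    rw [Matrix.det_of_isUpperTriangular hup, isUnit_iff_ne_zero]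
    exact Finset.prod_ne_zero_iff.mpr fun a _ => hdiag _ _ (by simp [e])
  refine ⟨(1 : Matrix (Fin t) (Fin t) ℂ).submatrix id e * (M.submatrix id e)⁻¹, ?_⟩
  have hsub : M * (1 : Matrix (Fin t) (Fin t) ℂ).submatrix id e = M.submatrix id e := by
    ext a b
    simp [Matrix.mul_apply, Matrix.one_apply]
  rw [← Matrix.mul_assoc, hsub, Matrix.mul_nonsing_inv _ hdet]

/-- If the superdiagonal blocks of `A` have left inverses, then the superdiagonal part of `A` can be
cancelled on the right of matrices whose leading block column is zero. -/
theorem exists_superdiagonal_left_inverse {k : ℕ} {s t u : Fin k → ℕ}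
    (A : Matrix (Σ i : Fin k, Fin (s i)) (Σ i : Fin k, Fin (t i)) ℂ)
    (hA : ∀ i j : Fin k, (j : ℕ) = (i : ℕ) + 1 → ∃ L : Matrix (Fin (t j)) (Fin (s i)) ℂ,
      L * Matrix.of (fun a b => A ⟨i, a⟩ ⟨j, b⟩) = 1) :
    ∃ L : Matrix (Σ i : Fin k, Fin (t i)) (Σ i : Fin k, Fin (s i)) ℂ,
      IsBlockUpper (-1) L ∧
      ∀ X : Matrix (Σ i : Fin k, Fin (u i)) (Σ i : Fin k, Fin (t i)) ℂ, IsBlockUpper 1 X →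
        X * L * Matrix.of (fun p q => if (q.1 : ℕ) = (p.1 : ℕ) + 1 then A p q else 0) = X := by
  choose L hL using hA
  let L' : Matrix (Σ i : Fin k, Fin (t i)) (Σ i : Fin k, Fin (s i)) ℂ :=
    fun q p => if h : (q.1 : ℕ) = (p.1 : ℕ) + 1 then L p.1 q.1 h q.2 p.2 else 0
  have hmul : L' * Matrix.of (fun p q => if (q.1 : ℕ) = (p.1 : ℕ) + 1 then A p q else 0) =
      Matrix.diagonal fun q => if (q.1 : ℕ) = 0 then 0 else 1 := by
    ext ⟨j, b⟩ ⟨j', b'⟩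
    rw [Matrix.mul_apply, Fintype.sum_sigma]
    by_cases hj : (j : ℕ) = 0
    · rw [Finset.sum_eq_zero fun i _ => Finset.sum_eq_zero fun a _ => ?_]
      · simp [Matrix.diagonal_apply, hj]
      · simp [L', hj]
    · have hlt := j.isLt
      obtain ⟨i, hi⟩ : ∃ i : Fin k, (j : ℕ) = (i : ℕ) + 1 := ⟨⟨j - 1, by omega⟩, by simp; omega⟩
      rw [Finset.sum_eq_single i]
      · by_cases hjj : j = j'
        · subst hjj
          have := congrFun (congrFun (hL i j hi) b) b'
          rw [Matrix.mul_apply] at this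
          simpa [L', hi, Matrix.diagonal_apply, Matrix.one_apply] using this
        · have h1 : ¬ (j' : ℕ) = (i : ℕ) + 1 := fun h => hjj (Fin.ext (by omega))
          simp [h1, hjj]
      · intro i' _ hne
        have h1 : ¬ (j : ℕ) = (i' : ℕ) + 1 := fun h => hne (Fin.ext (by omega))
        simp [L', h1]
      · simp
  refine ⟨L', fun q p h => dif_neg (by omega), fun X hX => ?_⟩
  rw [Matrix.mul_assoc, hmul]
  ext p q
  rw [Matrix.mul_diagonal]
  split_ifs with h
  · rw [hX p q (by omega), zero_mul]
  · rw [mul_one]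

/-- If the diagonal blocks of `E` have right inverses, so does the block diagonal part of `E`. -/
theorem exists_blockDiagonal_right_inverse {k : ℕ} {s t : Fin k → ℕ}
    (E : Matrix (Σ i : Fin k, Fin (s i)) (Σ i : Fin k, Fin (t i)) ℂ)
    (hE : ∀ i : Fin k, ∃ R : Matrix (Fin (t i)) (Fin (s i)) ℂ,
      Matrix.of (fun a b => E ⟨i, a⟩ ⟨i, b⟩) * R = 1) :
    ∃ R : Matrix (Σ i : Fin k, Fin (t i)) (Σ i : Fin k, Fin (s i)) ℂ,
      IsBlockUpper 0 R ∧ Matrix.of (fun p q => if q.1 = p.1 then E p q else 0) * R = 1 := by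
  choose R hR using hE
  refine ⟨Matrix.blockDiagonal' R, fun q p h => ?_, ?_⟩
  · refine Matrix.blockDiagonal'_apply_ne R _ _ fun h' => ?_
    rw [h'] at h
    omega
  · have hd : Matrix.of (fun p q => if q.1 = p.1 then E p q else 0) =
        Matrix.blockDiagonal' fun i => Matrix.of fun a b => E ⟨i, a⟩ ⟨i, b⟩ := by
      ext ⟨i, a⟩ ⟨j, b⟩
      by_cases h : i = j
      · subst h
        simp [Matrix.blockDiagonal'_apply_eq]
      · simp [Matrix.blockDiagonal'_apply_ne _ _ _ h, Ne.symm h]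
    rw [hd, ← Matrix.blockDiagonal'_mul]
    simp only [hR]
    exact Matrix.blockDiagonal'_one

/-- Lemma on block bidiagonalization. Let `Ã + λẼ` be a pencil in special
staircase form with row blocks of sizes `s 0, …, s (k-1)` and column blocks of sizes
`t 0, …, t (k-1)`: `Ã` is block strictly upper triangular with superdiagonal blocks
`A_{i,i+1} = [Â_{i,i+1}; 0]`, `Â_{i,i+1}` invertible upper triangular; `Ẽ` is block upper
triangular with diagonal blocks `E_{i,i} = [0 Ê_{i,i}]`, `Ê_{i,i}` invertible upper
triangular. Then there exist unit upper triangular `S`, `T` such that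
`S⁻¹ (Ã + λẼ) T` (equivalently `(Ã + λẼ) T = S ⬝ (bidiagonal)`) is the block bidiagonal
pencil retaining exactly the rank-carrying stairs `λE_{i,i}` and `A_{i,i+1}`. -/
theorem staircase_to_block_bidiagonal
    (k : ℕ) (s t : Fin k → ℕ)
    (hst : ∀ i : Fin k, s i ≤ t i)
    (hts : ∀ i j : Fin k, (j : ℕ) = (i : ℕ) + 1 → t j ≤ s i)
    (A E : Matrix (Σ i : Fin k, Fin (s i)) (Σ i : Fin k, Fin (t i)) ℂ)
    -- `Ã` block upper triangular with zero block diagonal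
    (hA0 : ∀ p q, q.1 ≤ p.1 → A p q = 0)
    -- `Ẽ` block upper triangular
    (hE0 : ∀ p q, q.1 < p.1 → E p q = 0)
    -- superdiagonal blocks of `Ã` of the form `[Â; 0]`, `Â` invertible upper triangular
    (hAtri : ∀ p q, (q.1 : ℕ) = (p.1 : ℕ) + 1 → (q.2 : ℕ) < (p.2 : ℕ) → A p q = 0)
    (hAdiag : ∀ p q, (q.1 : ℕ) = (p.1 : ℕ) + 1 → (q.2 : ℕ) = (p.2 : ℕ) → A p q ≠ 0)
    -- diagonal blocks of `Ẽ` of the form `[0 Ê]`, `Ê` invertible upper triangular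
    (hEtri : ∀ p q, q.1 = p.1 → (q.2 : ℕ) < t q.1 - s p.1 + (p.2 : ℕ) → E p q = 0)
    (hEdiag : ∀ p q, q.1 = p.1 → (q.2 : ℕ) = t q.1 - s p.1 + (p.2 : ℕ) → E p q ≠ 0) :
    ∃ (S : Matrix (Σ i : Fin k, Fin (s i)) (Σ i : Fin k, Fin (s i)) ℂ)
      (T : Matrix (Σ i : Fin k, Fin (t i)) (Σ i : Fin k, Fin (t i)) ℂ),
      -- `S` and `T` are unit upper triangular
      (∀ p q, blkLT q p → S p q = 0) ∧ (∀ p, S p p = 1) ∧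
      (∀ p q, blkLT q p → T p q = 0) ∧ (∀ p, T p p = 1) ∧
      A * T = S * Matrix.of (fun p q => if (q.1 : ℕ) = (p.1 : ℕ) + 1 then A p q else 0) ∧
      E * T = S * Matrix.of (fun p q => if q.1 = p.1 then E p q else 0) := by
  obtain ⟨L, hLup, hL⟩ := exists_superdiagonal_left_inverse (u := s) A fun i j hij =>
    exists_left_inverse_of_stair (hts i j hij) _ (fun a b => hAtri ⟨i, a⟩ ⟨j, b⟩ hij)
      (fun a b => hAdiag ⟨i, a⟩ ⟨j, b⟩ hij)
  obtain ⟨R, hRup, hR⟩ := exists_blockDiagonal_right_inverse E fun i =>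
    exists_right_inverse_of_stair (hst i) _ (fun a b => hEtri ⟨i, a⟩ ⟨i, b⟩ rfl)
      (fun a b => hEdiag ⟨i, a⟩ ⟨i, b⟩ rfl)
  set Ab : Matrix (Σ i : Fin k, Fin (s i)) (Σ i : Fin k, Fin (t i)) ℂ :=
    Matrix.of (fun p q => if (q.1 : ℕ) = (p.1 : ℕ) + 1 then A p q else 0) with hAb
  set Eb : Matrix (Σ i : Fin k, Fin (s i)) (Σ i : Fin k, Fin (t i)) ℂ :=
    Matrix.of (fun p q => if q.1 = p.1 then E p q else 0) with hEb
  have hAup : IsBlockUpper 1 A := fun p q h => hA0 p q (Fin.le_def.mpr (by omega))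
  have hAs : IsBlockUpper 2 (A - Ab) := by
    intro p q h
    rw [Matrix.sub_apply, hAb, Matrix.of_apply]
    split_ifs with hpq
    · exact sub_self _
    · rw [hA0 p q (Fin.le_def.mpr (by omega)), sub_zero]
  have hEbup : IsBlockUpper 0 Eb := by
    intro p q h
    rw [hEb, Matrix.of_apply, if_neg]
    intro h'
    rw [h'] at h
    omega
  have hEs : IsBlockUpper 1 (E - Eb) := by
    intro p q h
    rw [Matrix.sub_apply, hEb, Matrix.of_apply]
    split_ifs with hpq
    · exact sub_self _
    · rw [hE0 p q (lt_of_le_of_ne (Fin.le_def.mpr (by omega)) hpq), sub_zero]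
  have hQ : IsBlockUpper (-1) (L * Eb) := hLup.mul hEbup
  have hC : IsBlockUpper 1 (R * (A - Ab) * (L * Eb) - R * (E - Eb)) :=
    (((hRup.mul hAs).mul hQ).mono (by norm_num)).sub ((hRup.mul hEs).mono (by norm_num))
  obtain ⟨N, hN, hNeq⟩ := IsBlockUpper.exists_fixedPoint hC ((hRup.mul hAup).mono (by norm_num)) hQ
    ((hRup.mul hEs).mono (by norm_num))
  have hX : IsBlockUpper 2 (A - Ab + A * N) := hAs.add ((hAup.mul hN).mono (by norm_num))
  have hS := ((hX.mul hLup).mono (by norm_num : (1 : ℤ) ≤ 2 + -1)).one_add_unitUpper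
  have hT := hN.one_add_unitUpper
  refine ⟨1 + (A - Ab + A * N) * L, 1 + N, hS.1, hS.2, hT.1, hT.2, ?_, ?_⟩
  · rw [Matrix.add_mul, hL _ (hX.mono (by norm_num)), Matrix.mul_add, Matrix.mul_one, Matrix.one_mul]
    abel
  · have hN' : N = R * ((A - Ab + A * N) * L * Eb - (E - Eb) * (1 + N)) := by
      conv_lhs => rw [hNeq]
      simp only [Matrix.mul_add, Matrix.add_mul, Matrix.mul_sub, Matrix.sub_mul, Matrix.mul_assoc,
        Matrix.mul_one]
      abel
    have hEN : Eb * N = (A - Ab + A * N) * L * Eb - (E - Eb) * (1 + N) := by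
      conv_lhs => rw [hN', ← Matrix.mul_assoc, hR, Matrix.one_mul]
    have hsplit : E * (1 + N) = Eb + Eb * N + (E - Eb) * (1 + N) := by
      simp only [Matrix.mul_add, Matrix.sub_mul, Matrix.mul_one]
      abel
    rw [hsplit, hEN, Matrix.add_mul 1, Matrix.one_mul]
    abel

end
end

section
/- Let L_0,L_1∈ℂ^{m×n} and let P∈ℂ^{m×m}, Q∈ℂ^{n×n} be invertible matrices such that A+λE := P^{−1}(L_0+λL_1)Q is in staircase form with indices s_1,…,s_k and t_1,…,t_k. Then for every j=1,…,k the Wong subspaces of the pencil L_0+λL_1 at 0 satisfy: 𝒱_j equals the column span of the first τ_j=t_1+…+t_j columns of Q, and 𝒰_j equals the column span of the first σ_j=s_1+…+s_j columns of P. In particular dim 𝒱_j=τ_j and dim 𝒰_j=σ_j. -/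
open Polynomial Matrix

noncomputable section

/-- The Wong sequence of subspaces `𝒰_i ⊆ ℂ^m` of the pencil `L₀ + λL₁` at the eigenvalue `0`:
`𝒰₀ = {0}`, `𝒰_{i+1} = L₁ (L₀⁻¹ 𝒰_i)` (image under `L₁` of the preimage under `L₀`). -/
def wongU {m n : ℕ} (L0 L1 : Matrix (Fin m) (Fin n) ℂ) : ℕ → Submodule ℂ (Fin m → ℂ)
  | 0 => ⊥
  | i + 1 =>
      Submodule.map (Matrix.mulVecLin L1)
        (Submodule.comap (Matrix.mulVecLin L0) (wongU L0 L1 i))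

/-- The Wong sequence of subspaces `𝒱_i ⊆ ℂ^n` at `0`: `𝒱_i = L₀⁻¹ 𝒰_{i-1}`. -/
def wongV {m n : ℕ} (L0 L1 : Matrix (Fin m) (Fin n) ℂ) (i : ℕ) : Submodule ℂ (Fin n → ℂ) :=
  Submodule.comap (Matrix.mulVecLin L0) (wongU L0 L1 (i - 1))

section Staircase

variable {K : Type*} [Field K]

lemma mulVec_injective_of_rank_eq {p q : ℕ} {M : Matrix (Fin p) (Fin q) K} (h : M.rank = q) :
    Function.Injective M.mulVec := by
  have h1 := LinearMap.finrank_range_add_finrank_ker M.mulVecLin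
  rw [Module.finrank_fin_fun] at h1
  have h2 : Module.finrank K (LinearMap.ker M.mulVecLin) = 0 := by
    rw [Matrix.rank] at h
    omega
  exact LinearMap.ker_eq_bot.mp (Submodule.finrank_eq_zero.mp h2)

lemma mulVec_surjective_of_rank_eq {p q : ℕ} {M : Matrix (Fin p) (Fin q) K} (h : M.rank = p) :
    Function.Surjective M.mulVec := by
  have hrange : LinearMap.range M.mulVecLin = ⊤ := by
    apply Submodule.eq_top_of_finrank_eq
    rw [Module.finrank_fin_fun]
    exact h
  exact LinearMap.range_eq_top.mp hrange

/-- The vectors supported on the first `c` of the blocks of sizes `s 0, …, s (k-1), r`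
(all of which except the last, when `c = k`). -/
def leadingCoords (K : Type*) [Field K] {k : ℕ} (s : Fin k → ℕ) (r c : ℕ) :
    Submodule K ((Σ i : Fin k, Fin (s i)) ⊕ Fin r → K) where
  carrier := {x | (∀ (i : Fin k) (a : Fin (s i)), c ≤ i → x (Sum.inl ⟨i, a⟩) = 0) ∧
    ∀ b, x (Sum.inr b) = 0}
  add_mem' := fun hx hy =>
    ⟨fun i a h => by simp [hx.1 i a h, hy.1 i a h], fun b => by simp [hx.2 b, hy.2 b]⟩
  zero_mem' := ⟨fun _ _ _ => rfl, fun _ => rfl⟩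
  smul_mem' := fun z x hx =>
    ⟨fun i a h => by simp [hx.1 i a h], fun b => by simp [hx.2 b]⟩

variable {k : ℕ} {s t : Fin k → ℕ} {r q : ℕ}

lemma mem_leadingCoords {c : ℕ} {x : (Σ i : Fin k, Fin (s i)) ⊕ Fin r → K} :
    x ∈ leadingCoords K s r c ↔
      (∀ (i : Fin k) (a : Fin (s i)), c ≤ i → x (Sum.inl ⟨i, a⟩) = 0) ∧
        ∀ b, x (Sum.inr b) = 0 := Iff.rfl

lemma leadingCoords_zero : leadingCoords K s r 0 = ⊥ := by
  refine eq_bot_iff.mpr fun x hx => ?_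
  rw [Submodule.mem_bot]
  ext (⟨i, a⟩ | b)
  · exact hx.1 i a (Nat.zero_le _)
  · exact hx.2 b

lemma leadingCoords_mono {c d : ℕ} (h : c ≤ d) :
    leadingCoords K s r c ≤ leadingCoords K s r d :=
  fun _ hx => ⟨fun i a hi => hx.1 i a (h.trans hi), hx.2⟩

lemma mulVec_blocks {ι : Type*} (M : Matrix ι ((Σ i : Fin k, Fin (t i)) ⊕ Fin q) K)
    (x : (Σ i : Fin k, Fin (t i)) ⊕ Fin q → K) (u : ι) :
    M.mulVec x u = (∑ j, ∑ b, M u (Sum.inl ⟨j, b⟩) * x (Sum.inl ⟨j, b⟩)) +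
      ∑ b, M u (Sum.inr b) * x (Sum.inr b) := by
  simp [Matrix.mulVec, dotProduct, Fintype.sum_sum_type, Fintype.sum_sigma]

lemma map_leadingCoords {m : ℕ} (M : Matrix (Fin m) ((Σ i : Fin k, Fin (t i)) ⊕ Fin q) K)
    (j : Fin k) :
    (leadingCoords K t q (j + 1)).map M.mulVecLin = Submodule.span K
      {w : Fin m → K | ∃ (i : Fin k) (c : Fin (t i)), i ≤ j ∧
        w = fun rw => M rw (Sum.inl ⟨i, c⟩)} := by
  apply le_antisymm
  · rintro _ ⟨x, hx, rfl⟩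
    have key : M.mulVecLin x =
        ∑ i, ∑ b, x (Sum.inl ⟨i, b⟩) • (fun rw => M rw (Sum.inl ⟨i, b⟩)) := by
      ext u
      simp [mulVec_blocks, hx.2, Finset.sum_apply, mul_comm]
    rw [key]
    refine Submodule.sum_mem _ fun i _ => Submodule.sum_mem _ fun b _ => ?_
    by_cases hij : i ≤ j
    · exact Submodule.smul_mem _ _ (Submodule.subset_span ⟨i, b, hij, rfl⟩)
    · rw [hx.1 i b (by simpa [Nat.succ_le_iff] using hij), zero_smul]
      exact zero_mem _
  · refine Submodule.span_le.mpr ?_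
    rintro _ ⟨i, c, hij, rfl⟩
    refine ⟨Pi.single (Sum.inl ⟨i, c⟩) 1, ⟨fun i' a hi => ?_, fun b => by simp⟩, ?_⟩
    · refine Pi.single_eq_of_ne (fun h => ?_) _
      obtain rfl : i' = i := congrArg Sigma.fst (Sum.inl.inj h)
      have : (i' : ℕ) ≤ j := hij
      omega
    · ext u
      simp [Matrix.mulVec_single]

lemma finrank_span_leading_cols {m : ℕ}
    {M : Matrix (Fin m) ((Σ i : Fin k, Fin (t i)) ⊕ Fin q) K}
    (hM : Function.Injective M.mulVecLin) (j : Fin k) :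
    Module.finrank K (Submodule.span K
      {w : Fin m → K | ∃ (i : Fin k) (c : Fin (t i)), i ≤ j ∧
        w = fun rw => M rw (Sum.inl ⟨i, c⟩)}) =
      ∑ i ∈ Finset.univ.filter (fun i : Fin k => i ≤ j), t i := by
  have hcol : LinearIndependent K M.col := Matrix.mulVec_injective_iff.mp hM
  let e : (Σ i : {i : Fin k // i ≤ j}, Fin (t i)) → (Σ i : Fin k, Fin (t i)) ⊕ Fin q :=
    fun p => Sum.inl ⟨p.1, p.2⟩
  have he : Function.Injective e := by
    rintro ⟨⟨i, hi⟩, a⟩ ⟨⟨i', hi'⟩, a'⟩ h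
    simp only [e, Sum.inl.injEq, Sigma.mk.injEq] at h
    obtain ⟨rfl, h⟩ := h
    rw [eq_of_heq h]
  have hset : {w : Fin m → K | ∃ (i : Fin k) (c : Fin (t i)), i ≤ j ∧
      w = fun rw => M rw (Sum.inl ⟨i, c⟩)} = Set.range (M.col ∘ e) := by
    ext w
    constructor
    · rintro ⟨i, c, hij, rfl⟩
      exact ⟨⟨⟨i, hij⟩, c⟩, rfl⟩
    · rintro ⟨⟨⟨i, hij⟩, c⟩, rfl⟩
      exact ⟨i, c, hij, rfl⟩
  rw [hset, finrank_span_eq_card (hcol.comp e he), Fintype.card_sigma]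
  simp only [Fintype.card_fin]
  exact (Finset.sum_subtype _ (by simp) _).symm

lemma comap_leadingCoords
    {A : Matrix ((Σ i : Fin k, Fin (s i)) ⊕ Fin r) ((Σ i : Fin k, Fin (t i)) ⊕ Fin q) K}
    (hA0 : ∀ (i : Fin k) (a : Fin (s i)) (j : Fin k) (b : Fin (t j)), j ≤ i →
      A (Sum.inl ⟨i, a⟩) (Sum.inl ⟨j, b⟩) = 0)
    (hA0' : ∀ (u : Fin r) (j : Fin k) (b : Fin (t j)), A (Sum.inr u) (Sum.inl ⟨j, b⟩) = 0)
    (hAsup : ∀ i j : Fin k, (j : ℕ) = (i : ℕ) + 1 →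
      (Matrix.of fun (a : Fin (s i)) (b : Fin (t j)) =>
        A (Sum.inl ⟨i, a⟩) (Sum.inl ⟨j, b⟩)).rank = t j)
    (hAr : (Matrix.of fun (u : Fin r) (v : Fin q) => A (Sum.inr u) (Sum.inr v)).rank = q)
    (c : ℕ) :
    (leadingCoords K s r c).comap A.mulVecLin = leadingCoords K t q (c + 1) := by
  ext x
  rw [Submodule.mem_comap, Matrix.mulVecLin_apply]
  constructor
  · intro hx
    have hr : (fun b => x (Sum.inr b)) = 0 := by
      apply mulVec_injective_of_rank_eq hAr
      rw [Matrix.mulVec_zero]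
      ext u
      simpa [mulVec_blocks, hA0', Matrix.mulVec, dotProduct] using hx.2 u
    have hr' (b) : x (Sum.inr b) = 0 := congrFun hr b
    refine ⟨?_, hr'⟩
    suffices h : ∀ d (j : Fin k), k = j + 1 + d → c + 1 ≤ j →
        ∀ b : Fin (t j), x (Sum.inl ⟨j, b⟩) = 0 from
      fun j b hj => h (k - (j + 1)) j (by omega) hj b
    intro d
    induction d using Nat.strong_induction_on with
    | _ d ih =>
      intro j hd hj
      let i : Fin k := ⟨j - 1, by omega⟩
      have hij : (j : ℕ) = (i : ℕ) + 1 := by simp only [i]; omega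
      have hb : (fun b => x (Sum.inl ⟨j, b⟩)) = 0 := by
        apply mulVec_injective_of_rank_eq (hAsup i j hij)
        rw [Matrix.mulVec_zero]
        ext a
        have hia := hx.1 i a (by omega)
        rw [mulVec_blocks, Finset.sum_eq_single j] at hia
        · simpa [hr', Matrix.mulVec, dotProduct] using hia
        · intro j' _ hne
          refine Finset.sum_eq_zero fun b _ => ?_
          by_cases hle : j' ≤ i
          · rw [hA0 i a j' b hle, zero_mul]
          · have h1 : (i : ℕ) < j' := not_le.mp hle
            have h2 : (j' : ℕ) ≠ j := fun h => hne (Fin.ext h)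
            rw [ih (k - (j' + 1)) (by omega) j' (by omega) (by omega) b, mul_zero]
        · simp
      exact fun b => congrFun hb b
  · intro hx
    refine ⟨fun i a hi => ?_, fun u => by simp [mulVec_blocks, hA0', hx.2]⟩
    simp only [mulVec_blocks, hx.2, mul_zero, Finset.sum_const_zero, add_zero]
    refine Finset.sum_eq_zero fun j _ => Finset.sum_eq_zero fun b _ => ?_
    by_cases hji : j ≤ i
    · rw [hA0 i a j b hji, zero_mul]
    · have : (i : ℕ) < j := not_le.mp hji
      rw [hx.1 j b (by omega), mul_zero]

lemma map_leadingCoords_eq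
    {E : Matrix ((Σ i : Fin k, Fin (s i)) ⊕ Fin r) ((Σ i : Fin k, Fin (t i)) ⊕ Fin q) K}
    (hE0 : ∀ (i : Fin k) (a : Fin (s i)) (j : Fin k) (b : Fin (t j)), j < i →
      E (Sum.inl ⟨i, a⟩) (Sum.inl ⟨j, b⟩) = 0)
    (hE0' : ∀ (u : Fin r) (j : Fin k) (b : Fin (t j)), E (Sum.inr u) (Sum.inl ⟨j, b⟩) = 0)
    (hEdiag : ∀ i : Fin k, (Matrix.of fun (a : Fin (s i)) (b : Fin (t i)) =>
      E (Sum.inl ⟨i, a⟩) (Sum.inl ⟨i, b⟩)).rank = s i)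
    {c : ℕ} (hc : c ≤ k) :
    (leadingCoords K t q c).map E.mulVecLin = leadingCoords K s r c := by
  have hle (d : ℕ) : (leadingCoords K t q d).map E.mulVecLin ≤ leadingCoords K s r d := by
    rintro _ ⟨x, hx, rfl⟩
    refine ⟨fun i a hi => ?_, fun u => by simp [mulVec_blocks, hE0', hx.2]⟩
    simp only [Matrix.mulVecLin_apply, mulVec_blocks, hx.2, mul_zero, Finset.sum_const_zero,
      add_zero]
    refine Finset.sum_eq_zero fun j _ => Finset.sum_eq_zero fun b _ => ?_
    by_cases hji : j < i
    · rw [hE0 i a j b hji, zero_mul]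
    · have : (i : ℕ) ≤ j := not_lt.mp hji
      rw [hx.1 j b (by omega), mul_zero]
  refine le_antisymm (hle c) ?_
  induction c with
  | zero => simp [leadingCoords_zero]
  | succ c ih =>
    intro y hy
    let i : Fin k := ⟨c, hc⟩
    obtain ⟨z, hz⟩ := mulVec_surjective_of_rank_eq (hEdiag i) fun a => y (Sum.inl ⟨i, a⟩)
    let x : (Σ i : Fin k, Fin (t i)) ⊕ Fin q → K :=
      Sum.elim (fun p => if h : p.1 = i then z (h ▸ p.2) else 0) 0
    have hx : x ∈ leadingCoords K t q (c + 1) := by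
      refine ⟨fun j b hj => dif_neg fun h => ?_, fun b => rfl⟩
      have : (j : ℕ) = c := congrArg Fin.val h
      omega
    have hxi (a : Fin (s i)) : E.mulVec x (Sum.inl ⟨i, a⟩) = y (Sum.inl ⟨i, a⟩) := by
      rw [mulVec_blocks, Finset.sum_eq_single i]
      · simpa [x, Matrix.mulVec, dotProduct] using congrFun hz a
      · intro j _ hne
        simp [x, hne]
      · simp
    have hEx := hle (c + 1) (Submodule.mem_map_of_mem hx)
    have hdiff : y - E.mulVecLin x ∈ leadingCoords K s r c := by
      have hsub := Submodule.sub_mem _ hy hEx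
      refine ⟨fun j a hj => ?_, hsub.2⟩
      rcases hj.eq_or_lt with h | h
      · obtain rfl : i = j := Fin.ext h
        simp [hxi]
      · exact hsub.1 j a h
    rw [← sub_add_cancel y (E.mulVecLin x)]
    exact Submodule.add_mem _
      (Submodule.map_mono (leadingCoords_mono c.le_succ) (ih (by omega) hdiff))
      (Submodule.mem_map_of_mem hx)

lemma comap_map_of_mul_eq {m n : ℕ} {ι κ : Type*} [Fintype ι] [Fintype κ]
    {L : Matrix (Fin m) (Fin n) K} {P : Matrix (Fin m) ι K} {Q : Matrix (Fin n) κ K}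
    {A : Matrix ι κ K} (hP : Function.Injective P.mulVecLin)
    (hQ : Function.Surjective Q.mulVecLin) (h : P * A = L * Q) (S : Submodule K (ι → K)) :
    (S.map P.mulVecLin).comap L.mulVecLin = (S.comap A.mulVecLin).map Q.mulVecLin := by
  have hL (x) : L.mulVecLin (Q.mulVecLin x) = P.mulVecLin (A.mulVecLin x) := by
    simp [Matrix.mulVec_mulVec, h]
  ext v
  obtain ⟨x, rfl⟩ := hQ v
  constructor
  · rintro ⟨y, hy, hyx⟩
    rw [hL] at hyx
    exact ⟨x, by simpa [← hP hyx] using hy, rfl⟩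
  · rintro ⟨x', hx', hxx⟩
    rw [← hxx]
    exact ⟨A.mulVecLin x', hx', (hL x').symm⟩

lemma map_map_of_mul_eq {m n : ℕ} {ι κ : Type*} [Fintype ι] [Fintype κ]
    {L : Matrix (Fin m) (Fin n) K} {P : Matrix (Fin m) ι K} {Q : Matrix (Fin n) κ K}
    {E : Matrix ι κ K} (h : P * E = L * Q) (S : Submodule K (κ → K)) :
    (S.map Q.mulVecLin).map L.mulVecLin = (S.map E.mulVecLin).map P.mulVecLin := by
  rw [← Submodule.map_comp, ← Submodule.map_comp, ← Matrix.mulVecLin_mul,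
    ← Matrix.mulVecLin_mul, h]

end Staircase

/-- If `P⁻¹ (L₀ + λL₁) Q = A + λE` is in staircase form with indices
`s 0, …, s (k-1)` and `t 0, …, t (k-1)` (columns of `P` and `Q` indexed blockwise, trailing
blocks of sizes `m − Σs` and `n − Σt`), then for every `j` the Wong subspace `𝒱_{j+1}` is the
span of the columns of `Q` in blocks `≤ j` (i.e. its first `τ_{j+1}` columns) and `𝒰_{j+1}`
is the span of the columns of `P` in blocks `≤ j`; in particular their dimensions are
`τ_{j+1} = Σ_{i≤j} t i` and `σ_{j+1} = Σ_{i≤j} s i`. -/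
theorem wong_subspaces_of_staircase_form
    {m n k : ℕ} (s t : Fin k → ℕ) (L0 L1 : Matrix (Fin m) (Fin n) ℂ)
    (P : Matrix (Fin m) ((Σ i : Fin k, Fin (s i)) ⊕ Fin (m - ∑ i, s i)) ℂ)
    (Q : Matrix (Fin n) ((Σ i : Fin k, Fin (t i)) ⊕ Fin (n - ∑ i, t i)) ℂ)
    (hsm : (∑ i, s i) ≤ m) (htn : (∑ i, t i) ≤ n)
    (hP : Function.Bijective P.mulVecLin) (hQ : Function.Bijective Q.mulVecLin)
    (A E : Matrix ((Σ i : Fin k, Fin (s i)) ⊕ Fin (m - ∑ i, s i))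
      ((Σ i : Fin k, Fin (t i)) ⊕ Fin (n - ∑ i, t i)) ℂ)
    (hPA : P * A = L0 * Q) (hPE : P * E = L1 * Q)
    -- staircase form: zero pattern of A
    (hA0 : ∀ (i : Fin k) (a : Fin (s i)) (j : Fin k) (b : Fin (t j)), j ≤ i →
      A (Sum.inl ⟨i, a⟩) (Sum.inl ⟨j, b⟩) = 0)
    (hA0' : ∀ (rr : Fin (m - ∑ i, s i)) (j : Fin k) (b : Fin (t j)),
      A (Sum.inr rr) (Sum.inl ⟨j, b⟩) = 0)
    -- staircase form: zero pattern of E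
    (hE0 : ∀ (i : Fin k) (a : Fin (s i)) (j : Fin k) (b : Fin (t j)), j < i →
      E (Sum.inl ⟨i, a⟩) (Sum.inl ⟨j, b⟩) = 0)
    (hE0' : ∀ (rr : Fin (m - ∑ i, s i)) (j : Fin k) (b : Fin (t j)),
      E (Sum.inr rr) (Sum.inl ⟨j, b⟩) = 0)
    -- superdiagonal blocks of A have full column rank
    (hAsup : ∀ i j : Fin k, (j : ℕ) = (i : ℕ) + 1 →
      (Matrix.of fun (a : Fin (s i)) (b : Fin (t j)) =>
        A (Sum.inl ⟨i, a⟩) (Sum.inl ⟨j, b⟩)).rank = t j)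
    -- the trailing block of A has full column rank
    (hAr : (Matrix.of fun (rr : Fin (m - ∑ i, s i)) (cc : Fin (n - ∑ i, t i)) =>
      A (Sum.inr rr) (Sum.inr cc)).rank = n - ∑ i, t i)
    -- diagonal blocks of E have full row rank
    (hEdiag : ∀ i : Fin k,
      (Matrix.of fun (a : Fin (s i)) (b : Fin (t i)) =>
        E (Sum.inl ⟨i, a⟩) (Sum.inl ⟨i, b⟩)).rank = s i) :
    ∀ j : Fin k,
      wongV L0 L1 ((j : ℕ) + 1)
        = Submodule.span ℂ
            {w : Fin n → ℂ | ∃ (i : Fin k) (c : Fin (t i)), i ≤ j ∧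
              w = fun rw => Q rw (Sum.inl ⟨i, c⟩)} ∧
      wongU L0 L1 ((j : ℕ) + 1)
        = Submodule.span ℂ
            {w : Fin m → ℂ | ∃ (i : Fin k) (c : Fin (s i)), i ≤ j ∧
              w = fun rw => P rw (Sum.inl ⟨i, c⟩)} ∧
      Module.finrank ℂ (wongV L0 L1 ((j : ℕ) + 1))
        = ∑ i ∈ Finset.univ.filter (fun i : Fin k => i ≤ j), t i ∧
      Module.finrank ℂ (wongU L0 L1 ((j : ℕ) + 1))
        = ∑ i ∈ Finset.univ.filter (fun i : Fin k => i ≤ j), s i := by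
  have hstep (c : ℕ) (hU : wongU L0 L1 c = (leadingCoords ℂ s _ c).map P.mulVecLin) :
      wongV L0 L1 (c + 1) = (leadingCoords ℂ t _ (c + 1)).map Q.mulVecLin := by
    rw [wongV, Nat.add_sub_cancel, hU, comap_map_of_mul_eq hP.1 hQ.2 hPA,
      comap_leadingCoords hA0 hA0' hAsup hAr]
  have hU (c : ℕ) (hc : c ≤ k) :
      wongU L0 L1 c = (leadingCoords ℂ s _ c).map P.mulVecLin := by
    induction c with
    | zero => simp [wongU, leadingCoords_zero]
    | succ c ih =>
      change (wongV L0 L1 (c + 1)).map L1.mulVecLin = _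
      rw [hstep c (ih (by omega)), map_map_of_mul_eq hPE,
        map_leadingCoords_eq hE0 hE0' hEdiag hc]
  intro j
  have hVj := (hstep j (hU j j.isLt.le)).trans (map_leadingCoords Q j)
  have hUj := (hU (j + 1) j.isLt).trans (map_leadingCoords P j)
  exact ⟨hVj, hUj, by rw [hVj, finrank_span_leading_cols hQ.1],
    by rw [hUj, finrank_span_leading_cols hP.1]⟩

end
end

section
/- Let L(λ)=L_0+λL_1∈ℂ[λ]^{m×n} be a matrix pencil. Then L(λ) is right invertible over ℂ[λ] if and only if L(λ) has no finite eigenvalues and no left minimal indices; equivalently, if and only if rank_ℂ(L_0+μL_1)=m for every μ∈ℂ. Moreover, in that case L(λ) admits a polynomial right inverse of degree at most m−1. -/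
open Polynomial Matrix

noncomputable section

theorem rank_eq_of_mul_eq_one {K : Type*} [Field K] {m n : ℕ} {A : Matrix (Fin m) (Fin n) K}
    {B : Matrix (Fin n) (Fin m) K} (h : A * B = 1) : A.rank = m := by
  apply le_antisymm
  · simpa using A.rank_le_height
  · have := Matrix.rank_mul_le_left A B
    rw [h, Matrix.rank_one] at this
    simpa using this

theorem vecMul_eq_zero_of_rank_eq {K : Type*} [Field K] {m n : ℕ} {A : Matrix (Fin m) (Fin n) K}
    (h : A.rank = m) {v : Fin m → K} (hv : v ᵥ* A = 0) : v = 0 := by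
  have hli : LinearIndependent K A.row := by
    rw [linearIndependent_iff_card_eq_finrank_span, Set.finrank, ← Matrix.rank_eq_finrank_span_row,
      h, Fintype.card_fin]
  exact Matrix.vecMul_injective_iff.mpr hli (by simpa using hv)

theorem evalMat_pencilMat {ι κ : Type*} (L0 L1 : Matrix ι κ ℂ) (μ : ℂ) :
    evalMat (pencilMat L0 L1) μ = L0 + μ • L1 := by
  ext i j
  simp [evalMat, pencilMat]
  ring

theorem rank_evalMat_of_mul_eq_one {m n : ℕ} {P : Matrix (Fin m) (Fin n) ℂ[X]}
    {R : Matrix (Fin n) (Fin m) ℂ[X]} (h : P * R = 1) (μ : ℂ) : (evalMat P μ).rank = m := by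
  apply rank_eq_of_mul_eq_one (B := evalMat R μ)
  have := congrArg (fun M => M.map (Polynomial.evalRingHom μ)) h
  rw [Matrix.map_mul, Matrix.map_one _ (map_zero _) (map_one _)] at this
  exact this

theorem normalRank_of_mul_eq_one {m n : ℕ} {P : Matrix (Fin m) (Fin n) ℂ[X]}
    {R : Matrix (Fin n) (Fin m) ℂ[X]} (h : P * R = 1) : normalRank P = m := by
  apply rank_eq_of_mul_eq_one (B := toRat R)
  have := congrArg (fun M => M.map (algebraMap ℂ[X] (RatFunc ℂ))) h
  simpa [Matrix.map_mul, toRat] using this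

/-- A linear map `Y` on polynomials for which a linear factor can be cancelled from every kernel
element of degree at most `m` either is injective on these polynomials or kills `1`. -/
theorem map_one_eq_zero_of_cancel_linear {V : Type*} [AddCommGroup V] [Module ℂ V]
    (Y : ℂ[X] →ₗ[ℂ] V) (m : ℕ)
    (hY : ∀ (a : ℂ) (q : ℂ[X]), q.degree < m → Y ((X - C a) * q) = 0 → Y q = 0) :
    ∀ (d : ℕ) (q : ℂ[X]), q ≠ 0 → q.natDegree = d → d ≤ m → Y q = 0 → Y 1 = 0 := by
  intro d
  induction d with
  | zero =>
    intro q hq hd _ h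
    rw [Polynomial.eq_C_of_natDegree_eq_zero hd] at hq h
    rw [← mul_one (C (q.coeff 0)), ← Polynomial.smul_eq_C_mul, map_smul] at h
    exact (smul_eq_zero.mp h).resolve_left fun h0 => hq (by rw [h0, C_0])
  | succ d ih =>
    intro q hq hd hdm h
    obtain ⟨a, ha⟩ := IsAlgClosed.exists_root q fun h0 => by
      rw [Polynomial.degree_eq_natDegree hq, hd] at h0
      norm_cast at h0
    obtain ⟨p, rfl⟩ := Polynomial.dvd_iff_isRoot.mpr ha
    have hp : p ≠ 0 := right_ne_zero_of_mul hq
    rw [Polynomial.natDegree_mul (X_sub_C_ne_zero a) hp, natDegree_X_sub_C] at hd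
    have hpd : p.natDegree = d := by omega
    refine ih p hp hpd (by omega) (hY a p ?_ h)
    rw [Polynomial.degree_eq_natDegree hp, hpd]
    exact_mod_cast hdm

theorem exists_natDegree_le_map_eq_zero {m : ℕ} (Y : ℂ[X] →ₗ[ℂ] (Fin m → ℂ)) :
    ∃ q : ℂ[X], q ≠ 0 ∧ q.natDegree ≤ m ∧ Y q = 0 := by
  have hlt : Module.finrank ℂ (Fin m → ℂ) < Module.finrank ℂ (Fin (m + 1) → ℂ) := by simp
  let T : (Fin (m + 1) → ℂ) →ₗ[ℂ] (Fin m → ℂ) :=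
    Y ∘ₗ (degreeLT ℂ (m + 1)).subtype ∘ₗ (degreeLTEquiv ℂ (m + 1)).symm.toLinearMap
  obtain ⟨v, hv, hv0⟩ := Submodule.exists_mem_ne_zero_of_ne_bot
    (LinearMap.ker_ne_bot_of_finrank_lt (f := T) hlt)
  have hq0 : ((degreeLTEquiv ℂ (m + 1)).symm v : ℂ[X]) ≠ 0 := by simpa using hv0
  refine ⟨_, hq0, ?_, hv⟩
  have := Polynomial.mem_degreeLT.mp ((degreeLTEquiv ℂ (m + 1)).symm v).2
  exact Nat.lt_succ_iff.mp ((Polynomial.natDegree_lt_iff_degree_lt hq0).mpr this)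

theorem pencilMat_mulVec_single {m n : ℕ} (L0 L1 : Matrix (Fin m) (Fin n) ℂ) (j : Fin n)
    (q : ℂ[X]) :
    pencilMat L0 L1 *ᵥ Pi.single j q =
      ∑ i, (L0 i j • (Pi.single i q : Fin m → ℂ[X]) +
        L1 i j • (Pi.single i (X * q) : Fin m → ℂ[X])) := by
  ext1 i
  rw [Finset.sum_apply]
  simp only [Pi.add_apply, Pi.smul_apply, Pi.single_apply, Polynomial.smul_eq_C_mul, mul_ite,
    mul_zero, Finset.sum_add_distrib, Finset.sum_ite_eq, Finset.mem_univ, if_true, pencilMat,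
    Matrix.mulVec_single, Matrix.col_apply, Matrix.of_apply, MulOpposite.smul_eq_mul_unop,
    MulOpposite.unop_op]
  ring

theorem exists_mulVec_eq_single {m n : ℕ} (L0 L1 : Matrix (Fin m) (Fin n) ℂ)
    (h : ∀ μ : ℂ, (evalMat (pencilMat L0 L1) μ).rank = m) (k : Fin m) :
    ∃ x : Fin n → ℂ[X], (∀ i, (x i).degree < m) ∧ pencilMat L0 L1 *ᵥ x = Pi.single k 1 := by
  let F : (Fin n → ℂ[X]) →ₗ[ℂ] (Fin m → ℂ[X]) :=
    (pencilMat L0 L1).mulVecLin.restrictScalars ℂ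
  let U := (Submodule.pi Set.univ fun _ : Fin n => degreeLT ℂ m).map F
  by_contra hk
  have hkU : (Pi.single k 1 : Fin m → ℂ[X]) ∉ U := by
    rintro ⟨x, hx, hxk⟩
    exact hk ⟨x, fun i => Polynomial.mem_degreeLT.mp (hx i trivial), hxk⟩
  obtain ⟨φ, hφk, hφU⟩ := Submodule.exists_le_ker_of_notMem hkU
  let Y : ℂ[X] →ₗ[ℂ] (Fin m → ℂ) :=
    LinearMap.pi fun i => φ ∘ₗ LinearMap.single ℂ (fun _ : Fin m => ℂ[X]) i
  have hYapp (q : ℂ[X]) (i : Fin m) : Y q i = φ (Pi.single i q) := rfl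
  have hrel (q : ℂ[X]) (hq : q.degree < m) : Y q ᵥ* L0 + Y (X * q) ᵥ* L1 = 0 := by
    ext j
    have hmem : pencilMat L0 L1 *ᵥ Pi.single j q ∈ U := by
      refine ⟨Pi.single j q, fun i _ => ?_, rfl⟩
      rcases eq_or_ne i j with rfl | hij
      · simpa using Polynomial.mem_degreeLT.mpr hq
      · simp [Pi.single_eq_of_ne hij]
    have := LinearMap.mem_ker.mp (hφU hmem)
    rw [pencilMat_mulVec_single, map_sum] at this
    simpa [Matrix.vecMul, dotProduct, hYapp, Finset.sum_add_distrib, mul_comm] using this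
  have hcancel (a : ℂ) (q : ℂ[X]) (hq : q.degree < m) (h0 : Y ((X - C a) * q) = 0) :
      Y q = 0 := by
    have hX : Y (X * q) = a • Y q := by
      rwa [sub_mul, map_sub, ← Polynomial.smul_eq_C_mul, map_smul, sub_eq_zero] at h0
    apply vecMul_eq_zero_of_rank_eq (h a)
    rw [evalMat_pencilMat, Matrix.vecMul_add, Matrix.vecMul_smul, ← Matrix.smul_vecMul, ← hX]
    exact hrel q hq
  obtain ⟨q, hq0, hqd, hq⟩ := exists_natDegree_le_map_eq_zero Y
  have h1 := map_one_eq_zero_of_cancel_linear Y m hcancel _ q hq0 rfl hqd hq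
  exact hφk (congrFun h1 k)

theorem exists_right_inverse_natDegree_le {m n : ℕ} (L0 L1 : Matrix (Fin m) (Fin n) ℂ)
    (h : ∀ μ : ℂ, (evalMat (pencilMat L0 L1) μ).rank = m) :
    ∃ R : Matrix (Fin n) (Fin m) ℂ[X], pencilMat L0 L1 * R = 1 ∧
      ∀ i j, (R i j).natDegree ≤ m - 1 := by
  choose x hdeg hx using exists_mulVec_eq_single L0 L1 h
  refine ⟨Matrix.of fun i j => x j i, ?_, fun i j => ?_⟩
  · ext1 i j
    have := congrFun (hx j) i
    rw [Pi.single_apply] at this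
    rw [Matrix.one_apply]
    exact this
  · have hm : 0 < m := j.pos
    refine Polynomial.natDegree_le_iff_degree_le.mpr ?_
    refine Polynomial.degree_le_iff_coeff_zero _ _ |>.mpr fun d hd => ?_
    refine Polynomial.coeff_eq_zero_of_degree_lt ((hdeg j i).trans_le ?_)
    have : m - 1 < d := by exact_mod_cast hd
    exact_mod_cast (by omega : m ≤ d)

/-- Lemma on right invertible pencils. A pencil `L(λ) = L₀ + λL₁` is right
invertible over `ℂ[λ]` iff it has no finite eigenvalues (the rank of `L(μ)` equals the normal
rank for all `μ ∈ ℂ`) and no left minimal indices (the normal rank equals `m`); equivalently,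
iff `rank (L₀ + μL₁) = m` for every `μ ∈ ℂ`. Moreover, in that case there exists a polynomial
right inverse of degree at most `m − 1`. -/
theorem pencil_right_invertible_iff
    {m n : ℕ} (L0 L1 : Matrix (Fin m) (Fin n) ℂ) :
    ((∃ R : Matrix (Fin n) (Fin m) (Polynomial ℂ), pencilMat L0 L1 * R = 1) ↔
      ((∀ μ : ℂ, (evalMat (pencilMat L0 L1) μ).rank = normalRank (pencilMat L0 L1)) ∧
        normalRank (pencilMat L0 L1) = m)) ∧
    ((∃ R : Matrix (Fin n) (Fin m) (Polynomial ℂ), pencilMat L0 L1 * R = 1) ↔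
      (∀ μ : ℂ, (evalMat (pencilMat L0 L1) μ).rank = m)) ∧
    ((∃ R : Matrix (Fin n) (Fin m) (Polynomial ℂ), pencilMat L0 L1 * R = 1) →
      ∃ R : Matrix (Fin n) (Fin m) (Polynomial ℂ), pencilMat L0 L1 * R = 1 ∧
        ∀ i j, (R i j).natDegree ≤ m - 1) := by
  have hinv {R : Matrix (Fin n) (Fin m) ℂ[X]} (hR : pencilMat L0 L1 * R = 1) (μ : ℂ) :=
    rank_evalMat_of_mul_eq_one hR μ
  have hex := exists_right_inverse_natDegree_le L0 L1
  refine ⟨⟨?_, ?_⟩, ⟨?_, ?_⟩, ?_⟩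
  · rintro ⟨R, hR⟩
    have hn := normalRank_of_mul_eq_one hR
    exact ⟨fun μ => (hinv hR μ).trans hn.symm, hn⟩
  · rintro ⟨h, hn⟩
    obtain ⟨R, hR, -⟩ := hex fun μ => (h μ).trans hn
    exact ⟨R, hR⟩
  · rintro ⟨R, hR⟩
    exact hinv hR
  · intro h
    obtain ⟨R, hR, -⟩ := hex h
    exact ⟨R, hR⟩
  · rintro ⟨R, hR⟩
    exact hex (hinv hR)

end
end
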